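/- arXiv:1904.01211 — 4 statements merged into one kernel-verified Lean document; each statement's English description precedes it below -/
import Mathlib

section
/- Let f : ℝⁿ → ℝ be a nondegenerate integrable log-concave function. Then there exists a pair (A₀, t₀) consisting of an invertible affine map A₀ on ℝⁿ and a real number t₀ such that e^{-‖A₀x‖₂ + t₀} ≥ f(x) for all x ∈ ℝⁿ and ∫_{ℝⁿ} e^{-‖A₀x‖₂ + t₀} dx = min{ ∫_{ℝⁿ} e^{-‖Ax‖₂ + t} dx : t ∈ ℝ, A an invertible affine map, e^{-‖Ax‖₂ + t} ≥ f(x) for all x ∈ ℝⁿ }; moreover this minimum equals n!·vol(B₂ⁿ)·e^{t₀}/|det A₀|. The number t₀ is unique, and A₀ is unique up to left composition with an orthogonal transformation (i.e., if (A₁, t₁) is another minimizing pair then t₁ = t₀ and A₁ = O·A₀ for some orthogonal O). -/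
open MeasureTheory Metric Set

noncomputable section

abbrev En (n : ℕ) := EuclideanSpace ℝ (Fin n)

/-- `f` is log-concave: `f = e^{-ψ}` with `ψ : ℝⁿ → ℝ ∪ {∞}` convex, expressed via
nonnegativity and the multiplicative concavity inequality. -/
def LogConcaveFn {n : ℕ} (f : En n → ℝ) : Prop :=
  (∀ x, 0 ≤ f x) ∧
  ∀ x y : En n, ∀ l : ℝ, 0 ≤ l → l ≤ 1 →
    f x ^ l * f y ^ (1 - l) ≤ f (l • x + (1 - l) • y)

lemma integral_exp_sub_norm {n : ℕ} (T : Matrix (Fin n) (Fin n) ℝ) (a : En n) (t : ℝ)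
    (hT : T.det ≠ 0) :
    (∫ x, Real.exp (t - ‖Matrix.toEuclideanLin T x + a‖)) =
      (n.factorial : ℝ) * (volume (closedBall (0 : En n) 1)).toReal * Real.exp t / |T.det| := by
  have hdet : LinearMap.det (Matrix.toEuclideanLin T) = T.det := LinearMap.det_toLpLin 2 T
  have hbase : (∫ x : En n, Real.exp (-‖x‖)) =
      (n.factorial : ℝ) * (volume (closedBall (0 : En n) 1)).toReal := by
    have h := measure_unitBall_eq_integral_div_gamma (E := En n) volume (p := 1) one_pos
    have hnn : 0 ≤ ∫ x : En n, Real.exp (-‖x‖) := integral_nonneg fun x => (Real.exp_pos _).le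
    rw [show volume (closedBall (0 : En n) 1) = volume (ball (0 : En n) 1) from
      (Measure.addHaar_unitClosedBall_eq_addHaar_unitBall volume), h]
    simp only [Real.rpow_one, div_one, finrank_euclideanSpace, Fintype.card_fin,
      Real.Gamma_nat_eq_factorial]
    rw [ENNReal.toReal_ofReal (by positivity)]
    field_simp
  let e : En n ≃ₗ[ℝ] En n := LinearMap.equivOfDetNeZero (Matrix.toEuclideanLin T) (hdet ▸ hT)
  have hemb : MeasurableEmbedding (Matrix.toEuclideanLin T) :=
    e.toContinuousLinearEquiv.toHomeomorph.measurableEmbedding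
  have hmap := hemb.integral_map (μ := volume) (fun y : En n => Real.exp (t - ‖y + a‖))
  rw [← hmap, Measure.map_linearMap_addHaar_eq_smul_addHaar volume (by rwa [hdet]),
    integral_smul_measure, integral_add_right_eq_self (fun y : En n => Real.exp (t - ‖y‖)),
    ENNReal.toReal_ofReal (abs_nonneg _), hdet]
  simp only [sub_eq_add_neg, Real.exp_add, integral_const_mul, hbase, abs_inv, smul_eq_mul]
  ring

lemma integral_exp_sub_norm_le_iff {n : ℕ} {T T' : Matrix (Fin n) (Fin n) ℝ} (a a' : En n)
    (t t' : ℝ) (hT : T.det ≠ 0) (hT' : T'.det ≠ 0) :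
    (∫ x, Real.exp (t - ‖Matrix.toEuclideanLin T x + a‖)) ≤
        (∫ x, Real.exp (t' - ‖Matrix.toEuclideanLin T' x + a'‖)) ↔
      Real.exp t / |T.det| ≤ Real.exp t' / |T'.det| := by
  rw [integral_exp_sub_norm T a t hT, integral_exp_sub_norm T' a' t' hT', mul_div_assoc,
    mul_div_assoc]
  have hvol : 0 < (volume (closedBall (0 : En n) 1)).toReal :=
    ENNReal.toReal_pos (measure_closedBall_pos _ _ one_pos).ne' measure_closedBall_lt_top.ne
  exact mul_le_mul_iff_right₀ (by positivity)

open scoped MatrixOrder in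
lemma Matrix.PosDef.exists_posDef_mul_self {n : ℕ} {A : Matrix (Fin n) (Fin n) ℝ}
    (hA : A.PosDef) : ∃ S : Matrix (Fin n) (Fin n) ℝ, S.PosDef ∧ S * S = A := by
  have hS : CFC.sqrt A * CFC.sqrt A = A := CFC.sqrt_mul_sqrt_self A hA.posSemidef.nonneg
  refine ⟨CFC.sqrt A, (Matrix.nonneg_iff_posSemidef.1 (CFC.sqrt_nonneg A)).posDef_iff_det_ne_zero.2
    fun h => ?_, hS⟩
  have := hA.det_pos
  rw [← hS, Matrix.det_mul, h] at this
  simp at this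

lemma Matrix.exists_orthogonal_mul_posDef {n : ℕ} (T : Matrix (Fin n) (Fin n) ℝ)
    (hT : T.det ≠ 0) : ∃ O ∈ Matrix.orthogonalGroup (Fin n) ℝ,
      ∃ P : Matrix (Fin n) (Fin n) ℝ, P.PosDef ∧ T = O * P := by
  have hpd : (T.transpose * T).PosDef := by
    have := (Matrix.posSemidef_conjTranspose_mul_self T)
    rw [Matrix.conjTranspose_eq_transpose_of_trivial] at this
    rw [this.posDef_iff_det_ne_zero, Matrix.det_mul, Matrix.det_transpose]
    exact mul_ne_zero hT hT
  obtain ⟨P, hP, hPP⟩ := hpd.exists_posDef_mul_self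
  have hPu : IsUnit P.det := hP.det_pos.ne'.isUnit
  have hPt : P.transpose = P := by
    simpa [Matrix.conjTranspose_eq_transpose_of_trivial] using hP.isHermitian.eq
  refine ⟨T * P⁻¹, ?_, P, hP, by rw [Matrix.mul_assoc, Matrix.nonsing_inv_mul _ hPu, mul_one]⟩
  rw [Matrix.mem_orthogonalGroup_iff', Matrix.transpose_mul,
    Matrix.transpose_nonsing_inv, hPt]
  calc P⁻¹ * T.transpose * (T * P⁻¹) = P⁻¹ * (T.transpose * T) * P⁻¹ := by
        simp only [Matrix.mul_assoc]
    _ = (P⁻¹ * P) * (P * P⁻¹) := by rw [← hPP]; simp only [Matrix.mul_assoc]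
    _ = 1 := by rw [Matrix.nonsing_inv_mul _ hPu, Matrix.mul_nonsing_inv _ hPu, mul_one]

lemma Matrix.PosDef.exists_simultaneous_diagonalization {n : ℕ} {A B : Matrix (Fin n) (Fin n) ℝ}
    (hA : A.PosDef) (hB : B.PosDef) :
    ∃ (G : Matrix (Fin n) (Fin n) ℝ) (d : Fin n → ℝ), (∀ i, 0 < d i) ∧
      A = G.transpose * G ∧ B = G.transpose * Matrix.diagonal d * G := by
  obtain ⟨S, hS, hSS⟩ := hA.exists_posDef_mul_self
  have hSu : IsUnit S.det := hS.det_pos.ne'.isUnit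
  have hSt : S.transpose = S := by
    simpa [Matrix.conjTranspose_eq_transpose_of_trivial] using hS.isHermitian.eq
  have hC : (S⁻¹ * B * S⁻¹).PosDef := by
    have := hB.conjTranspose_mul_mul_same (B := S⁻¹)
      (Matrix.mulVec_injective_iff_isUnit.2 hS.inv.isUnit)
    rwa [hS.inv.isHermitian.eq] at this
  obtain ⟨C, hCeq⟩ : ∃ C, C = S⁻¹ * B * S⁻¹ := ⟨_, rfl⟩
  rw [← hCeq] at hC
  have hsp := hC.isHermitian.spectral_theorem
  have hBC : B = S * C * S := by
    calc B = (S * S⁻¹) * B * (S⁻¹ * S) := by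
          rw [Matrix.nonsing_inv_mul _ hSu, Matrix.mul_nonsing_inv _ hSu, one_mul, mul_one]
      _ = _ := by rw [hCeq]; simp only [Matrix.mul_assoc]
  rw [Unitary.conjStarAlgAut_apply] at hsp
  set U : Matrix (Fin n) (Fin n) ℝ :=
    (hC.isHermitian.eigenvectorUnitary : Matrix (Fin n) (Fin n) ℝ)
  have hUU : U * U.transpose = 1 := by
    have := Unitary.coe_mul_star_self hC.isHermitian.eigenvectorUnitary
    rwa [Unitary.coe_star, Matrix.star_eq_conjTranspose,
      Matrix.conjTranspose_eq_transpose_of_trivial] at this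
  refine ⟨U.transpose * S, hC.isHermitian.eigenvalues, hC.eigenvalues_pos, ?_, ?_⟩
  · rw [Matrix.transpose_mul, hSt, Matrix.transpose_transpose]
    calc A = S * (U * U.transpose) * S := by rw [hUU, mul_one, hSS]
      _ = _ := by simp only [Matrix.mul_assoc]
  · rw [Matrix.transpose_mul, hSt, Matrix.transpose_transpose]
    have hsp' : C = U * Matrix.diagonal hC.isHermitian.eigenvalues * U.transpose := by
      simpa [Matrix.star_eq_conjTranspose, Matrix.conjTranspose_eq_transpose_of_trivial]
        using hsp
    calc B = S * C * S := hBC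
      _ = S * (U * Matrix.diagonal hC.isHermitian.eigenvalues * U.transpose) * S := by
        rw [← hsp']
      _ = _ := by simp only [Matrix.mul_assoc]

/-- Equality case of the log-concavity of the determinant on positive definite matrices. -/
lemma Matrix.PosDef.eq_of_sq_det_midpoint_le {n : ℕ} {A B : Matrix (Fin n) (Fin n) ℝ}
    (hA : A.PosDef) (hB : B.PosDef)
    (h : ((1 / 2 : ℝ) • (A + B)).det ^ 2 ≤ A.det * B.det) : A = B := by
  have hdetA := hA.det_pos
  obtain ⟨G, d, hd, rfl, rfl⟩ := hA.exists_simultaneous_diagonalization hB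
  have hG : 0 < G.det ^ 2 := by simpa [Matrix.det_mul, sq] using hdetA
  have hmid : (1 / 2 : ℝ) • (G.transpose * G + G.transpose * Matrix.diagonal d * G) =
      G.transpose * Matrix.diagonal (fun i => (1 + d i) / 2) * G := by
    have : Matrix.diagonal (fun i => (1 + d i) / 2) =
        (1 / 2 : ℝ) • ((1 : Matrix (Fin n) (Fin n) ℝ) + Matrix.diagonal d) := by
      rw [← Matrix.diagonal_one, Matrix.diagonal_add, ← Matrix.diagonal_smul]
      congr 1
      ext i
      simp
      ring
    rw [this, Matrix.mul_smul, Matrix.smul_mul, mul_add, add_mul, mul_one]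
  rw [hmid] at h
  simp only [Matrix.det_mul, Matrix.det_transpose, Matrix.det_diagonal] at h
  have h' : ∏ i, ((1 + d i) / 2) ^ 2 ≤ ∏ i, d i := by
    rw [Finset.prod_pow]
    have h4 : 0 < G.det ^ 2 * G.det ^ 2 := by positivity
    refine le_of_mul_le_mul_left ?_ h4
    linarith
  have hone : ∀ i, d i = 1 := by
    by_contra! hne
    obtain ⟨i, hi⟩ := hne
    refine absurd h' (not_le.2 ?_)
    refine Finset.prod_lt_prod (fun i _ => hd i) (fun j _ => ?_) ⟨i, Finset.mem_univ i, ?_⟩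
    · nlinarith [sq_nonneg (1 - d j)]
    · have : 0 < (1 - d i) ^ 2 := by
        have := sub_ne_zero.2 (Ne.symm hi)
        positivity
      nlinarith
  have : d = fun _ => 1 := funext hone
  rw [this, Matrix.diagonal_one, mul_one]

lemma LogConcaveFn.log_le_log {n : ℕ} {f : En n → ℝ} (hf : LogConcaveFn f) {x y : En n}
    (hx : 0 < f x) (hy : 0 < f y) {l : ℝ} (hl : 0 ≤ l) (hl' : l ≤ 1) :
    0 < f (l • x + (1 - l) • y) ∧
      l * Real.log (f x) + (1 - l) * Real.log (f y) ≤ Real.log (f (l • x + (1 - l) • y)) := by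
  have h := hf.2 x y l hl hl'
  have hp : 0 < f x ^ l * f y ^ (1 - l) := by positivity
  refine ⟨hp.trans_le h, ?_⟩
  have := Real.log_le_log hp h
  rwa [Real.log_mul (by positivity) (by positivity), Real.log_rpow hx, Real.log_rpow hy] at this

lemma LogConcaveFn.exists_closedBall_le {n : ℕ} {f : En n → ℝ} (hf : LogConcaveFn f)
    (hnd : (interior {x | 0 < f x}).Nonempty) :
    ∃ (x₀ : En n) (r δ : ℝ), 0 < r ∧ 0 < δ ∧ ∀ x ∈ closedBall x₀ r, δ ≤ f x := by
  obtain ⟨x₀, hx₀⟩ := hnd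
  obtain ⟨ε, hε, hball⟩ := Metric.isOpen_iff.1 isOpen_interior x₀ hx₀
  have hpos : ∀ x ∈ ball x₀ ε, 0 < f x := fun x hx =>
    interior_subset (s := {x | 0 < f x}) (hball hx)
  have hconc : ConcaveOn ℝ (ball x₀ ε) (fun x => Real.log (f x)) := by
    refine ⟨convex_ball _ _, fun x hx y hy a b ha hb hab => ?_⟩
    obtain rfl : b = 1 - a := by linarith
    exact (hf.log_le_log (hpos x hx) (hpos y hy) ha (by linarith)).2
  have hsub : closedBall x₀ (ε / 2) ⊆ ball x₀ ε := closedBall_subset_ball (by linarith)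
  obtain ⟨y, hy, hmin⟩ := (isCompact_closedBall x₀ (ε / 2)).exists_isMinOn
    ⟨x₀, mem_closedBall_self (by positivity)⟩ ((hconc.continuousOn isOpen_ball).mono hsub)
  exact ⟨x₀, ε / 2, f y, by positivity, hpos y (hsub hy), fun x hx =>
    (Real.log_le_log_iff (hpos y (hsub hy)) (hpos x (hsub hx))).1 (hmin hx)⟩

lemma mul_measureReal_le_integral {n : ℕ} {f : En n → ℝ} (hf : ∀ x, 0 ≤ f x)
    (hint : Integrable f) {s : Set (En n)} (hs : MeasurableSet s) (hs' : volume s ≠ ⊤) {c : ℝ}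
    (hc : ∀ x ∈ s, c ≤ f x) : c * volume.real s ≤ ∫ x, f x :=
  (setIntegral_ge_of_const_le_real hs hs' hc hint.integrableOn).trans
    (setIntegral_le_integral hint (Filter.Eventually.of_forall hf))

lemma LogConcaveFn.exists_le {n : ℕ} {f : En n → ℝ} (hf : LogConcaveFn f)
    (hint : Integrable f) {x₀ : En n} {r δ : ℝ} (hr : 0 < r) (hδ : 0 < δ)
    (hball : ∀ x ∈ closedBall x₀ r, δ ≤ f x) : ∃ M, ∀ x, f x ≤ M := by
  set v := volume.real (ball (0 : En n) (r / 2)) with hv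
  have hvpos : 0 < v := ENNReal.toReal_pos (measure_ball_pos _ _ (by positivity)).ne'
    measure_ball_lt_top.ne
  refine ⟨((∫ x, f x) / (v * δ ^ (1 / 2 : ℝ))) ^ 2, fun x => ?_⟩
  have hδ' : 0 < δ ^ (1 / 2 : ℝ) := by positivity
  have key := mul_measureReal_le_integral (c := f x ^ (1 / 2 : ℝ) * δ ^ (1 / 2 : ℝ)) hf.1 hint
    (s := ball ((1 / 2 : ℝ) • (x + x₀)) (r / 2)) measurableSet_ball measure_ball_lt_top.ne ?_
  · have hvol : volume.real (ball ((1 / 2 : ℝ) • (x + x₀)) (r / 2)) = v := by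
      rw [hv, measureReal_def, measureReal_def, Measure.addHaar_ball_center]
    rw [hvol] at key
    have hroot : f x ^ (1 / 2 : ℝ) ≤ (∫ x, f x) / (v * δ ^ (1 / 2 : ℝ)) := by
      rw [le_div_iff₀ (by positivity)]
      linarith
    have hfx : f x = (f x ^ (1 / 2 : ℝ)) ^ 2 := by
      rw [← Real.rpow_natCast, ← Real.rpow_mul (hf.1 x)]
      norm_num
    rw [hfx]
    have := Real.rpow_nonneg (hf.1 x) (1 / 2)
    gcongr
  · intro z hz
    have hy : (2 : ℝ) • z - x ∈ closedBall x₀ r := by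
      rw [mem_ball, dist_eq_norm] at hz
      rw [mem_closedBall, dist_eq_norm]
      have : (2 : ℝ) • z - x - x₀ = (2 : ℝ) • (z - (1 / 2 : ℝ) • (x + x₀)) := by module
      rw [this, norm_smul, Real.norm_of_nonneg zero_le_two]
      linarith
    have h := hf.2 x ((2 : ℝ) • z - x) (1 / 2) (by norm_num) (by norm_num)
    have hz' : (1 / 2 : ℝ) • x + (1 - 1 / 2 : ℝ) • ((2 : ℝ) • z - x) = z := by module
    rw [hz', show (1 - 1 / 2 : ℝ) = 1 / 2 by norm_num] at h
    refine le_trans ?_ h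
    have := Real.rpow_nonneg (hf.1 x) (1 / 2)
    gcongr
    exact hball _ hy

lemma LogConcaveFn.exists_lt_of_le_norm {n : ℕ} {f : En n → ℝ} (hf : LogConcaveFn f)
    (hint : Integrable f) {x₀ : En n} {r δ c : ℝ} (hr : 0 < r) (hc : 0 < c) (hcδ : c ≤ δ)
    (hball : ∀ x ∈ closedBall x₀ r, δ ≤ f x) :
    ∃ R, 0 < R ∧ ∀ x, R ≤ ‖x - x₀‖ → f x < c := by
  set v := volume.real (ball (0 : En n) (r / 2)) with hv
  have hvpos : 0 < v := ENNReal.toReal_pos (measure_ball_pos _ _ (by positivity)).ne'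
    measure_ball_lt_top.ne
  obtain ⟨N, hN⟩ := exists_nat_gt ((∫ x, f x) / (c * v))
  rw [div_lt_iff₀ (by positivity)] at hN
  refine ⟨2 * N * r + 1, by positivity, fun x hx => ?_⟩
  by_contra! hfx
  set D := ‖x - x₀‖ with hD
  have hDpos : 0 < D := lt_of_lt_of_le (by positivity) hx
  let p : ℕ → En n := fun i => x₀ + (i * r / D) • (x - x₀)
  have hdisj : ∀ i j, i ≠ j → Disjoint (ball (p i) (r / 2)) (ball (p j) (r / 2)) := by
    intro i j hij
    apply ball_disjoint_ball
    have hsub : p i - p j = (((i : ℝ) - j) * (r / D)) • (x - x₀) := by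
      simp only [p]
      module
    have hone : (1 : ℝ) ≤ |(i : ℝ) - j| := by
      have : (1 : ℤ) ≤ |(i : ℤ) - j| := Int.one_le_abs (by omega)
      exact_mod_cast this
    rw [dist_eq_norm, hsub, norm_smul, Real.norm_eq_abs, abs_mul, abs_of_pos (div_pos hr hDpos),
      ← hD, mul_assoc, div_mul_cancel₀ _ hDpos.ne']
    nlinarith
  have hge : ∀ i < N, ∀ z ∈ ball (p i) (r / 2), c ≤ f z := by
    intro i hi z hz
    obtain ⟨s, hs⟩ : ∃ s, s = i * r / D := ⟨_, rfl⟩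
    have hs0 : 0 ≤ s := by rw [hs]; positivity
    have hs1 : s ≤ 1 / 2 := by
      rw [hs, div_le_iff₀ hDpos]
      have : (i : ℝ) * r ≤ N * r := by
        have : (i : ℝ) ≤ N := by exact_mod_cast hi.le
        gcongr
      linarith
    have h1s : 0 < 1 - s := by linarith
    have hy : x₀ + (1 - s)⁻¹ • (z - p i) ∈ closedBall x₀ r := by
      rw [mem_ball, dist_eq_norm] at hz
      rw [mem_closedBall, dist_eq_norm, add_sub_cancel_left, norm_smul, norm_inv,
        Real.norm_of_nonneg h1s.le, inv_mul_le_iff₀ h1s]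
      nlinarith
    have hfy := hcδ.trans (hball _ hy)
    have hz' : s • x + (1 - s) • (x₀ + (1 - s)⁻¹ • (z - p i)) = z := by
      rw [smul_add, smul_inv_smul₀ h1s.ne']
      simp only [p, ← hs]
      module
    have h := hf.log_le_log (hc.trans_le hfx) (hc.trans_le hfy) hs0 (by linarith : s ≤ 1)
    rw [hz'] at h
    rw [← Real.log_le_log_iff hc h.1]
    have h1 := mul_le_mul_of_nonneg_left (Real.log_le_log hc hfx) hs0
    have h2 := mul_le_mul_of_nonneg_left (Real.log_le_log hc hfy) h1s.le
    linarith [h.2]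
  have hmeas : volume.real (⋃ i ∈ Finset.range N, ball (p i) (r / 2)) = N * v := by
    rw [measureReal_biUnion_finset (fun i _ j _ hij => hdisj i j hij)
      (fun i _ => measurableSet_ball) (fun i _ => measure_ball_lt_top.ne)]
    have : ∀ i, volume.real (ball (p i) (r / 2)) = v := fun i => by
      rw [hv, measureReal_def, measureReal_def, Measure.addHaar_ball_center]
    simp [this]
  have key := mul_measureReal_le_integral (c := c) hf.1 hint
    (s := ⋃ i ∈ Finset.range N, ball (p i) (r / 2))
    (Finset.measurableSet_biUnion _ fun i _ => measurableSet_ball)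
    ((measure_biUnion_lt_top (Finset.finite_toSet _) fun i _ => measure_ball_lt_top).ne) (by
      intro z hz
      simp only [mem_iUnion, Finset.mem_range] at hz
      obtain ⟨i, hi, hz⟩ := hz
      exact hge i hi z hz)
  rw [hmeas] at key
  linarith

lemma LogConcaveFn.exists_le_exp {n : ℕ} {f : En n → ℝ} (hf : LogConcaveFn f)
    (hint : Integrable f) {x₀ : En n} {r δ : ℝ} (hr : 0 < r) (hδ : 0 < δ)
    (hball : ∀ x ∈ closedBall x₀ r, δ ≤ f x) :
    ∃ c t : ℝ, 0 < c ∧ ∀ x, f x ≤ Real.exp (t - c * ‖x - x₀‖) := by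
  obtain ⟨M, hM⟩ := hf.exists_le hint hr hδ hball
  obtain ⟨R, hR, hfar⟩ := hf.exists_lt_of_le_norm hint (c := δ * Real.exp (-1)) hr (by positivity)
    (mul_le_of_le_one_right hδ.le (by simp)) hball
  have hfx₀ : δ ≤ f x₀ := hball x₀ (mem_closedBall_self hr.le)
  have hMpos : 0 < M := (hδ.trans_le hfx₀).trans_le (hM x₀)
  refine ⟨R⁻¹, max (Real.log δ) (Real.log M + 1), by positivity, fun x => ?_⟩
  rcases (hf.1 x).eq_or_lt with h0 | hpos
  · rw [← h0]
    positivity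
  rw [← Real.log_le_iff_le_exp hpos]
  rcases le_or_gt R ‖x - x₀‖ with hx | hx
  · set D := ‖x - x₀‖ with hD
    have hDpos : 0 < D := hR.trans_le hx
    have hl : R / D ≤ 1 := (div_le_one hDpos).2 hx
    have hl0 : 0 < R / D := by positivity
    have h := hf.log_le_log hpos (hδ.trans_le hfx₀) hl0.le hl
    have hy : R ≤ ‖(R / D) • x + (1 - R / D) • x₀ - x₀‖ := by
      have : (R / D) • x + (1 - R / D) • x₀ - x₀ = (R / D) • (x - x₀) := by module
      rw [this, norm_smul, Real.norm_of_nonneg hl0.le, ← hD, div_mul_cancel₀ _ hDpos.ne']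
    have hlt := Real.log_lt_log h.1 (hfar _ hy)
    rw [Real.log_mul hδ.ne' (Real.exp_pos _).ne', Real.log_exp] at hlt
    have h2 := mul_le_mul_of_nonneg_left (Real.log_le_log hδ hfx₀) (sub_nonneg.2 hl)
    have h3 : R / D * Real.log (f x) ≤ R / D * (Real.log δ - R⁻¹ * D) := by
      have : R / D * (R⁻¹ * D) = 1 := by field_simp
      linarith [h.2]
    have := le_of_mul_le_mul_left h3 hl0
    linarith [le_max_left (Real.log δ) (Real.log M + 1)]
  · have h1 := Real.log_le_log hpos (hM x)
    have h2 : R⁻¹ * ‖x - x₀‖ ≤ 1 := by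
      rw [inv_mul_le_iff₀ hR]
      linarith
    linarith [le_max_right (Real.log δ) (Real.log M + 1)]

lemma norm_apply_le_of_closedBall {n : ℕ} {L : En n →ₗ[ℝ] En n} {a x₀ : En n} {r s : ℝ}
    (hr : 0 < r) (h : ∀ x ∈ closedBall x₀ r, ‖L x + a‖ ≤ s) (y : En n) :
    ‖L y‖ ≤ s / r * ‖y‖ := by
  rcases eq_or_ne y 0 with rfl | hy
  · simp
  have hy' : 0 < ‖y‖ := norm_pos_iff.2 hy
  set u : En n := (r / ‖y‖) • y with hu
  have hun : ‖u‖ = r := by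
    rw [hu, norm_smul, Real.norm_of_nonneg (by positivity), div_mul_cancel₀ _ hy'.ne']
  have h1 := h (x₀ + u) (by simp [hun])
  have h2 := h (x₀ - u) (by simp [hun])
  have h3 : (2 : ℝ) • L u = (L (x₀ + u) + a) - (L (x₀ - u) + a) := by
    rw [map_add, map_sub]
    module
  have h4 : 2 * ‖L u‖ ≤ s + s := by
    rw [← Real.norm_of_nonneg (zero_le_two (α := ℝ)), ← norm_smul, h3]
    exact (norm_sub_le _ _).trans (add_le_add h1 h2)
  have h5 : ‖L u‖ = r / ‖y‖ * ‖L y‖ := by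
    rw [hu, map_smul, norm_smul, Real.norm_of_nonneg (by positivity)]
  rw [h5] at h4
  rw [div_mul_eq_mul_div, le_div_iff₀ hr]
  have : r / ‖y‖ * ‖L y‖ ≤ s := by linarith
  rw [div_mul_eq_mul_div, div_le_iff₀ hy'] at this
  linarith

lemma Matrix.abs_apply_le_of_norm_le {n : ℕ} {T : Matrix (Fin n) (Fin n) ℝ} {q : ℝ}
    (h : ∀ y : En n, ‖Matrix.toEuclideanLin T y‖ ≤ q * ‖y‖) (i j : Fin n) : |T i j| ≤ q := by
  have h1 := h (EuclideanSpace.single j 1)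
  have h2 := PiLp.norm_apply_le (Matrix.toEuclideanLin T (EuclideanSpace.single j 1)) i
  have h3 : Matrix.toEuclideanLin T (EuclideanSpace.single j 1) i = T i j := by
    simp [Matrix.toLpLin_apply]
  rw [h3, Real.norm_eq_abs] at h2
  rw [PiLp.norm_single, norm_one, mul_one] at h1
  exact h2.trans h1

lemma Matrix.abs_det_le_of_abs_le {n : ℕ} {T : Matrix (Fin n) (Fin n) ℝ} {q : ℝ}
    (h : ∀ i j, |T i j| ≤ q) : |T.det| ≤ n.factorial * q ^ n := by
  simpa using Matrix.det_le (abv := AbsoluteValue.abs) (x := q) h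

lemma le_of_exp_le_mul_pow {n : ℕ} {s K : ℝ} (hs : 0 ≤ s) (hK : 0 ≤ K)
    (h : Real.exp s ≤ K * s ^ n) : s ≤ K * (n + 1).factorial := by
  rcases hs.eq_or_lt with rfl | hs
  · positivity
  have h1 := (Real.pow_div_factorial_le_exp s hs.le (n + 1)).trans h
  rw [div_le_iff₀ (by positivity), pow_succ] at h1
  have : s ^ n * s ≤ s ^ n * (K * (n + 1).factorial) := by linarith
  exact le_of_mul_le_mul_left this (by positivity)

lemma exists_minimizer_of_closedBall {n : ℕ} {f : En n → ℝ} {x₀ : En n} {r δ : ℝ} (hr : 0 < r)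
    (hδ : 0 < δ) (hball : ∀ x ∈ closedBall x₀ r, δ ≤ f x)
    {T' : Matrix (Fin n) (Fin n) ℝ} {a' : En n} {t' : ℝ} (hT' : T'.det ≠ 0)
    (hfeas : ∀ x, f x ≤ Real.exp (t' - ‖Matrix.toEuclideanLin T' x + a'‖)) :
    ∃ (T₀ : Matrix (Fin n) (Fin n) ℝ) (a₀ : En n) (t₀ : ℝ), T₀.det ≠ 0 ∧
      (∀ x, f x ≤ Real.exp (t₀ - ‖Matrix.toEuclideanLin T₀ x + a₀‖)) ∧
      ∀ (T : Matrix (Fin n) (Fin n) ℝ) (a : En n) (t : ℝ), T.det ≠ 0 →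
        (∀ x, f x ≤ Real.exp (t - ‖Matrix.toEuclideanLin T x + a‖)) →
        Real.exp t₀ / |T₀.det| ≤ Real.exp t / |T.det| := by
  set C := Real.exp t' / |T'.det| with hC
  have hCpos : 0 < C := div_pos (Real.exp_pos _) (abs_pos.2 hT')
  let K : Set ((Fin n → Fin n → ℝ) × En n × ℝ) :=
    {p | (∀ x, f x ≤ Real.exp (p.2.2 - ‖Matrix.toEuclideanLin (Matrix.of p.1) x + p.2.1‖)) ∧
      Real.exp p.2.2 ≤ C * |(Matrix.of p.1).det|}
  have hcont : ∀ x : En n, Continuous fun p : (Fin n → Fin n → ℝ) × En n × ℝ =>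
      Matrix.toEuclideanLin (Matrix.of p.1) x := by
    intro x
    have : IsLinearMap ℝ (fun M : Fin n → Fin n → ℝ => Matrix.toEuclideanLin (Matrix.of M) x) :=
      ⟨fun M N => by rw [← Matrix.of_add_of, map_add]; rfl,
        fun c M => by rw [← Matrix.smul_of, map_smul]; rfl⟩
    exact (this.mk' _).continuous_of_finiteDimensional.comp continuous_fst
  have hdet : Continuous fun p : (Fin n → Fin n → ℝ) × En n × ℝ => (Matrix.of p.1).det :=
    Continuous.matrix_det continuous_fst
  have hclosed : IsClosed K := by
    have hclosed_sublevel : IsClosed {p : (Fin n → Fin n → ℝ) × En n × ℝ |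
        Real.exp p.2.2 ≤ C * |(Matrix.of p.1).det|} := isClosed_le (by fun_prop) (by fun_prop)
    have hclosed_feasible : IsClosed {p : (Fin n → Fin n → ℝ) × En n × ℝ | ∀ x,
        f x ≤ Real.exp (p.2.2 - ‖Matrix.toEuclideanLin (Matrix.of p.1) x + p.2.1‖)} := by
      rw [Set.ofPred_forall]
      refine isClosed_iInter fun x => isClosed_le continuous_const ?_
      have := hcont x
      fun_prop
    exact hclosed_feasible.inter hclosed_sublevel
  have hbdd : Bornology.IsBounded K := by
    obtain ⟨S, hS⟩ : ∃ S, S = C * n.factorial / (r ^ n * δ) * (n + 1).factorial := ⟨_, rfl⟩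
    have hS0 : 0 ≤ S := by rw [hS]; positivity
    have hmain : ∀ p ∈ K, (∀ i j, |p.1 i j| ≤ S / r) ∧ ‖p.2.1‖ ≤ S + S / r * ‖x₀‖ ∧
        |p.2.2| ≤ S + |Real.log δ| := by
      rintro ⟨M, a, t⟩ ⟨h1, h2⟩
      simp only at h1 h2 ⊢
      set s := t - Real.log δ with hs
      have hin : ∀ x ∈ closedBall x₀ r, ‖Matrix.toEuclideanLin (Matrix.of M) x + a‖ ≤ s := by
        intro x hx
        have := (Real.log_le_iff_le_exp hδ).2 ((hball x hx).trans (h1 x))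
        linarith
      have hx₀ := hin x₀ (mem_closedBall_self hr.le)
      have hs0 : 0 ≤ s := (norm_nonneg _).trans hx₀
      have hnorm := norm_apply_le_of_closedBall hr hin
      have hentry := Matrix.abs_apply_le_of_norm_le hnorm
      have hdet := Matrix.abs_det_le_of_abs_le hentry
      have hexp : Real.exp t = δ * Real.exp s := by
        rw [hs, Real.exp_sub, Real.exp_log hδ]
        field_simp
      have hsS : s ≤ S := by
        rw [hS]
        refine le_of_exp_le_mul_pow hs0 (by positivity) ?_
        have h3 : δ * Real.exp s ≤ C * (n.factorial * (s / r) ^ n) := by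
          rw [← hexp]
          exact h2.trans (by gcongr)
        rw [div_pow] at h3
        rw [div_mul_eq_mul_div, le_div_iff₀ (by positivity)]
        have h4 : C * (n.factorial * (s ^ n / r ^ n)) * r ^ n = C * n.factorial * s ^ n := by
          field_simp
        have h5 := mul_le_mul_of_nonneg_right h3 (pow_nonneg hr.le n)
        linarith
      have hsr : s / r ≤ S / r := by gcongr
      refine ⟨fun i j => (hentry i j).trans hsr, ?_, ?_⟩
      · have h6 : ‖a‖ ≤ ‖Matrix.toEuclideanLin (Matrix.of M) x₀ + a‖ +
            ‖Matrix.toEuclideanLin (Matrix.of M) x₀‖ := by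
          simpa using norm_sub_le (Matrix.toEuclideanLin (Matrix.of M) x₀ + a)
            (Matrix.toEuclideanLin (Matrix.of M) x₀)
        have h7 := hnorm x₀
        have h8 : s / r * ‖x₀‖ ≤ S / r * ‖x₀‖ := by gcongr
        linarith
      · have : t = s + Real.log δ := by rw [hs]; ring
        rw [this]
        refine (abs_add_le _ _).trans ?_
        rw [abs_of_nonneg hs0]
        gcongr
    refine (Metric.isBounded_closedBall (x := (0 : (Fin n → Fin n → ℝ) × En n × ℝ))
      (r := S / r + (S + S / r * ‖x₀‖) + (S + |Real.log δ|))).subset fun p hp => ?_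
    obtain ⟨h1, h2, h3⟩ := hmain p hp
    have hSr : 0 ≤ S / r := by positivity
    have hSx : 0 ≤ S / r * ‖x₀‖ := by positivity
    have hl := abs_nonneg (Real.log δ)
    rw [mem_closedBall_zero_iff, norm_prod_le_iff, norm_prod_le_iff,
      pi_norm_le_iff_of_nonneg (by linarith)]
    refine ⟨fun i => (pi_norm_le_iff_of_nonneg (by linarith)).2 fun j => ?_, by linarith, ?_⟩
    · rw [Real.norm_eq_abs]
      linarith [h1 i j]
    · rw [Real.norm_eq_abs]
      linarith
  have hKdet : ∀ p ∈ K, (Matrix.of p.1).det ≠ 0 := by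
    rintro p ⟨-, hp⟩ h0
    rw [h0, abs_zero, mul_zero] at hp
    exact absurd hp (not_le.2 (Real.exp_pos _))
  have hmem : ((fun i j => T' i j, a', t') : (Fin n → Fin n → ℝ) × En n × ℝ) ∈ K := by
    refine ⟨hfeas, ?_⟩
    change Real.exp t' ≤ C * |T'.det|
    rw [hC, div_mul_cancel₀ _ (abs_pos.2 hT').ne']
  have hobj : ContinuousOn (fun p : (Fin n → Fin n → ℝ) × En n × ℝ =>
      Real.exp p.2.2 / |(Matrix.of p.1).det|) K :=
    ContinuousOn.div (by fun_prop) (by fun_prop) fun p hp => (abs_pos.2 (hKdet p hp)).ne'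
  obtain ⟨p, hp, hmin⟩ :=
    (Metric.isCompact_of_isClosed_isBounded hclosed hbdd).exists_isMinOn ⟨_, hmem⟩ hobj
  refine ⟨Matrix.of p.1, p.2.1, p.2.2, hKdet p hp, hp.1, fun T a t hT hTf => ?_⟩
  rcases le_or_gt (Real.exp t) (C * |T.det|) with h | h
  · exact hmin (show ((fun i j => T i j, a, t) : (Fin n → Fin n → ℝ) × En n × ℝ) ∈ K
      from ⟨hTf, h⟩)
  · have h1 := hmin hmem
    have h2 : C ≤ Real.exp t / |T.det| := by
      rw [le_div_iff₀ (abs_pos.2 hT)]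
      exact h.le
    exact le_trans h1 h2

lemma le_exp_midpoint {n : ℕ} {y s t : ℝ} {u v : En n} (hs : y ≤ Real.exp (s - ‖u‖))
    (ht : y ≤ Real.exp (t - ‖v‖)) :
    y ≤ Real.exp ((s + t) / 2 - ‖(1 / 2 : ℝ) • (u + v)‖) := by
  have h1 : ‖(1 / 2 : ℝ) • (u + v)‖ ≤ (‖u‖ + ‖v‖) / 2 := by
    rw [norm_smul, Real.norm_of_nonneg (by norm_num)]
    linarith [norm_add_le u v]
  rcases le_total (s - ‖u‖) (t - ‖v‖) with h | h
  · exact hs.trans (Real.exp_le_exp.2 (by linarith))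
  · exact ht.trans (Real.exp_le_exp.2 (by linarith))

/-- A fixed gap between two centres can be traded for a simultaneous contraction and a
decrease in height. -/
lemma exists_contraction (n : ℕ) {D : ℝ} (hD : 0 < D) :
    ∃ ε η : ℝ, 0 < ε ∧ ε < 1 ∧ Real.exp (-η) < (1 - ε) ^ n ∧
      ∀ s w : ℝ, 0 ≤ s → 0 ≤ w → w ^ 2 ≤ s ^ 2 - D ^ 2 → (1 - ε) * w ≤ s - η := by
  obtain ⟨k, hk⟩ : ∃ k : ℝ, k = 2 * n + 1 := ⟨_, rfl⟩
  have hk1 : 1 ≤ k := by rw [hk]; linarith [(Nat.cast_nonneg n : (0 : ℝ) ≤ n)]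
  obtain ⟨ε, hε⟩ : ∃ ε, ε = min (1 / 2) (D ^ 2 / (2 * k ^ 2)) := ⟨_, rfl⟩
  have hε0 : 0 < ε := by rw [hε]; positivity
  have hε2 : ε ≤ 1 / 2 := hε ▸ min_le_left _ _
  have hεD : ε * (2 * k ^ 2) ≤ D ^ 2 := by
    rw [← le_div_iff₀ (by positivity)]
    exact hε ▸ min_le_right _ _
  refine ⟨ε, k * ε, hε0, by linarith, ?_, fun s w hs hw h => ?_⟩
  · have h1 : Real.exp (-(2 * ε)) ≤ 1 - ε := by
      rw [Real.exp_neg, inv_le_comm₀ (Real.exp_pos _) (by linarith)]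
      refine le_trans ?_ (Real.add_one_le_exp _)
      rw [inv_le_iff_one_le_mul₀ (by linarith)]
      nlinarith
    calc Real.exp (-(k * ε)) < Real.exp (n * (-(2 * ε))) := by
          apply Real.exp_lt_exp.2
          rw [hk]
          nlinarith
      _ = Real.exp (-(2 * ε)) ^ n := Real.exp_nat_mul _ _
      _ ≤ (1 - ε) ^ n := by gcongr
  · have hspos : 0 < s := by
      rcases hs.eq_or_lt with rfl | hs
      · nlinarith
      · exact hs
    have hws : w ≤ s := by nlinarith
    rcases le_total k s with hks | hks
    · nlinarith
    · have hkε : w ≤ s - k * ε := by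
        by_contra! hlt
        have h2 : (s - w) * (s + w) ≥ D ^ 2 := by nlinarith
        have h3 : (s - w) * (s + w) < k * ε * (2 * k) := by
          have h4 : (s - w) * (s + w) ≤ (s - w) * (2 * k) := by
            apply mul_le_mul_of_nonneg_left <;> linarith
          have h5 : (s - w) * (2 * k) < k * ε * (2 * k) := by
            apply mul_lt_mul_of_pos_right <;> linarith
          linarith
        nlinarith
      nlinarith

lemma offset_eq_of_minimizer {n : ℕ} {f : En n → ℝ} (hf : ∀ x, 0 ≤ f x)
    {T : Matrix (Fin n) (Fin n) ℝ} {a b : En n} {t : ℝ} (hT : T.det ≠ 0)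
    (ha : ∀ x, f x ≤ Real.exp (t - ‖Matrix.toEuclideanLin T x + a‖))
    (hb : ∀ x, f x ≤ Real.exp (t - ‖Matrix.toEuclideanLin T x + b‖))
    (hmin : ∀ (T' : Matrix (Fin n) (Fin n) ℝ) (a' : En n) (t' : ℝ), T'.det ≠ 0 →
      (∀ x, f x ≤ Real.exp (t' - ‖Matrix.toEuclideanLin T' x + a'‖)) →
      Real.exp t / |T.det| ≤ Real.exp t' / |T'.det|) : a = b := by
  by_contra hab
  have hD : 0 < ‖(1 / 2 : ℝ) • (a - b)‖ :=
    norm_pos_iff.2 (smul_ne_zero (by norm_num) (sub_ne_zero.2 hab))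
  obtain ⟨ε, η, hε0, hε1, hη, hcontr⟩ := exists_contraction n hD
  have h1ε : 0 < 1 - ε := by linarith
  have hdet : ((1 - ε) • T).det = (1 - ε) ^ n * T.det := by simp
  have hTabs := abs_pos.2 hT
  have h := hmin ((1 - ε) • T) ((1 - ε) • (1 / 2 : ℝ) • (a + b)) (t - η)
    (by rw [hdet]; positivity) fun x => ?_
  · rw [hdet, abs_mul, abs_of_pos (pow_pos h1ε n),
      div_le_div_iff₀ hTabs (by positivity), sub_eq_add_neg t, Real.exp_add] at h
    have h2 : Real.exp t * |T.det| * (1 - ε) ^ n ≤ Real.exp t * |T.det| * Real.exp (-η) := by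
      linarith
    exact absurd (le_of_mul_le_mul_left h2 (by positivity)) (not_le.2 hη)
  · rcases (hf x).eq_or_lt with h0 | hpos
    · rw [← h0]
      positivity
    have hax := (Real.log_le_iff_le_exp hpos).2 (ha x)
    have hbx := (Real.log_le_iff_le_exp hpos).2 (hb x)
    rw [← Real.log_le_iff_le_exp hpos]
    set u := Matrix.toEuclideanLin T x + a with hu
    set v := Matrix.toEuclideanLin T x + b with hv
    have hvec : Matrix.toEuclideanLin ((1 - ε) • T) x + (1 - ε) • (1 / 2 : ℝ) • (a + b) =
        (1 - ε) • (1 / 2 : ℝ) • (u + v) := by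
      rw [map_smul, LinearMap.smul_apply, hu, hv]
      module
    have hdiff : (1 / 2 : ℝ) • (a - b) = (1 / 2 : ℝ) • (u - v) := by
      rw [hu, hv]
      module
    have hpar : ‖(1 / 2 : ℝ) • (u + v)‖ ^ 2 + ‖(1 / 2 : ℝ) • (u - v)‖ ^ 2 =
        (‖u‖ ^ 2 + ‖v‖ ^ 2) / 2 := by
      have := parallelogram_law_with_norm ℝ u v
      simp only [norm_smul, Real.norm_of_nonneg (by norm_num : (0 : ℝ) ≤ 1 / 2)]
      linarith
    have hs0 : 0 ≤ t - Real.log (f x) := by linarith [norm_nonneg u]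
    have hu2 : ‖u‖ ^ 2 ≤ (t - Real.log (f x)) ^ 2 := by
      gcongr
      linarith
    have hv2 : ‖v‖ ^ 2 ≤ (t - Real.log (f x)) ^ 2 := by
      gcongr
      linarith
    have := hcontr (t - Real.log (f x)) ‖(1 / 2 : ℝ) • (u + v)‖ hs0 (norm_nonneg _)
      (by rw [hdiff]; linarith)
    rw [hvec, norm_smul, Real.norm_of_nonneg h1ε.le]
    linarith

lemma posDef_minimizer_unique {n : ℕ} {f : En n → ℝ} (hf : ∀ x, 0 ≤ f x)
    {A B : Matrix (Fin n) (Fin n) ℝ} {a b : En n} {s t : ℝ} (hA : A.PosDef) (hB : B.PosDef)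
    (ha : ∀ x, f x ≤ Real.exp (s - ‖Matrix.toEuclideanLin A x + a‖))
    (hb : ∀ x, f x ≤ Real.exp (t - ‖Matrix.toEuclideanLin B x + b‖))
    (hmin : ∀ (T : Matrix (Fin n) (Fin n) ℝ) (c : En n) (q : ℝ), T.det ≠ 0 →
      (∀ x, f x ≤ Real.exp (q - ‖Matrix.toEuclideanLin T x + c‖)) →
      Real.exp s / |A.det| ≤ Real.exp q / |T.det|)
    (heq : Real.exp s / |A.det| = Real.exp t / |B.det|) : A = B ∧ a = b ∧ s = t := by
  have hAd := hA.det_pos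
  have hBd := hB.det_pos
  have hAB : A = B := by
    apply hA.eq_of_sq_det_midpoint_le hB
    have hMd : 0 < ((1 / 2 : ℝ) • (A + B)).det :=
      ((hA.add hB).smul (by norm_num : (0 : ℝ) < 1 / 2)).det_pos
    have h := hmin ((1 / 2 : ℝ) • (A + B)) ((1 / 2 : ℝ) • (a + b)) ((s + t) / 2) hMd.ne'
      fun x => by
        have := le_exp_midpoint (ha x) (hb x)
        rwa [show (1 / 2 : ℝ) • (Matrix.toEuclideanLin A x + a + (Matrix.toEuclideanLin B x + b)) =
          Matrix.toEuclideanLin ((1 / 2 : ℝ) • (A + B)) x + (1 / 2 : ℝ) • (a + b) by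
            rw [map_smul, map_add, LinearMap.smul_apply, LinearMap.add_apply]
            module] at this
    rw [abs_of_pos hAd, abs_of_pos hMd] at h
    rw [abs_of_pos hAd, abs_of_pos hBd] at heq
    set m := ((1 / 2 : ℝ) • (A + B)).det with hm
    obtain ⟨V, hV⟩ : ∃ V, V = Real.exp s / A.det := ⟨_, rfl⟩
    have hVpos : 0 < V := by rw [hV]; positivity
    have hsV : Real.exp s = V * A.det := by rw [hV, div_mul_cancel₀ _ hAd.ne']
    have htV : Real.exp t = V * B.det := by rw [hV, heq, div_mul_cancel₀ _ hBd.ne']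
    have hsq : Real.exp ((s + t) / 2) ^ 2 = V ^ 2 * (A.det * B.det) := by
      rw [← Real.exp_nat_mul, show ((2 : ℕ) : ℝ) * ((s + t) / 2) = s + t by push_cast; ring,
        Real.exp_add, hsV, htV]
      ring
    rw [← hV, le_div_iff₀ hMd] at h
    have h2 : V ^ 2 * m ^ 2 ≤ V ^ 2 * (A.det * B.det) := by
      rw [← hsq, ← mul_pow]
      gcongr
    exact le_of_mul_le_mul_left h2 (by positivity)
  subst hAB
  have hst : s = t := by
    rw [div_left_inj' (abs_pos.2 hAd.ne').ne'] at heq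
    exact Real.exp_injective heq
  subst hst
  exact ⟨rfl, offset_eq_of_minimizer hf hAd.ne' ha hb hmin, rfl⟩

lemma Matrix.norm_toEuclideanLin_of_mem_orthogonalGroup {n : ℕ} {O : Matrix (Fin n) (Fin n) ℝ}
    (hO : O ∈ Matrix.orthogonalGroup (Fin n) ℝ) (x : En n) :
    ‖Matrix.toEuclideanLin O x‖ = ‖x‖ := by
  have h := (Matrix.mem_orthogonalGroup_iff' (Fin n) ℝ).1 hO
  rw [← sq_eq_sq₀ (norm_nonneg _) (norm_nonneg _), ← real_inner_self_eq_norm_sq,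
    ← real_inner_self_eq_norm_sq, ← LinearMap.adjoint_inner_right,
    ← Matrix.toEuclideanLin_conjTranspose_eq_adjoint,
    Matrix.conjTranspose_eq_transpose_of_trivial, ← LinearMap.comp_apply,
    ← Matrix.toLpLin_mul_same, h, Matrix.toLpLin_one, LinearMap.id_apply]

/-- Every affine map is an orthogonal transformation of one with positive definite linear part. -/
lemma exists_orthogonal_posDef_representation {n : ℕ} (T : Matrix (Fin n) (Fin n) ℝ) (a : En n)
    (hT : T.det ≠ 0) : ∃ O ∈ Matrix.orthogonalGroup (Fin n) ℝ,
      ∃ (P : Matrix (Fin n) (Fin n) ℝ) (b : En n), P.PosDef ∧ T = O * P ∧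
        a = Matrix.toEuclideanLin O b ∧ |T.det| = |P.det| ∧
        ∀ x, ‖Matrix.toEuclideanLin T x + a‖ = ‖Matrix.toEuclideanLin P x + b‖ := by
  obtain ⟨O, hO, P, hP, hTP⟩ := Matrix.exists_orthogonal_mul_posDef T hT
  have hOO := (Matrix.mem_orthogonalGroup_iff (Fin n) ℝ).1 hO
  have ha : a = Matrix.toEuclideanLin O (Matrix.toEuclideanLin O.transpose a) := by
    rw [← LinearMap.comp_apply, ← Matrix.toLpLin_mul_same, hOO, Matrix.toLpLin_one,
      LinearMap.id_apply]
  have hOd : |O.det| = 1 := by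
    have := congrArg Matrix.det hOO
    rw [Matrix.det_mul, Matrix.det_transpose, Matrix.det_one] at this
    rw [← abs_one, ← sq_eq_sq_iff_abs_eq_abs]
    linarith
  refine ⟨O, hO, P, Matrix.toEuclideanLin O.transpose a, hP, hTP, ha, ?_, fun x => ?_⟩
  · rw [hTP, Matrix.det_mul, abs_mul, hOd, one_mul]
  · conv_lhs => rw [ha, hTP, Matrix.toLpLin_mul_same, LinearMap.comp_apply, ← map_add]
    exact Matrix.norm_toEuclideanLin_of_mem_orthogonalGroup hO _

/-- existence, value and uniqueness (up to left orthogonal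
transformations) of the Löwner function of a nondegenerate integrable
log-concave function. -/
theorem lowner_function_exists_unique {n : ℕ}
    (f : En n → ℝ)
    (hlc : LogConcaveFn f)
    (hint : Integrable f)
    (hnd : (interior {x | 0 < f x}).Nonempty) :
    ∃ (T₀ : Matrix (Fin n) (Fin n) ℝ) (a₀ : En n) (t₀ : ℝ),
      T₀.det ≠ 0 ∧
      (∀ x, f x ≤ Real.exp (t₀ - ‖Matrix.toEuclideanLin T₀ x + a₀‖)) ∧
      (∀ (T : Matrix (Fin n) (Fin n) ℝ) (a : En n) (t : ℝ), T.det ≠ 0 →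
        (∀ x, f x ≤ Real.exp (t - ‖Matrix.toEuclideanLin T x + a‖)) →
        (∫ x, Real.exp (t₀ - ‖Matrix.toEuclideanLin T₀ x + a₀‖)) ≤
          ∫ x, Real.exp (t - ‖Matrix.toEuclideanLin T x + a‖)) ∧
      (∫ x, Real.exp (t₀ - ‖Matrix.toEuclideanLin T₀ x + a₀‖)) =
        (n.factorial : ℝ) * (volume (closedBall (0 : En n) 1)).toReal *
          Real.exp t₀ / |T₀.det| ∧
      (∀ (T₁ : Matrix (Fin n) (Fin n) ℝ) (a₁ : En n) (t₁ : ℝ), T₁.det ≠ 0 →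
        (∀ x, f x ≤ Real.exp (t₁ - ‖Matrix.toEuclideanLin T₁ x + a₁‖)) →
        (∀ (T : Matrix (Fin n) (Fin n) ℝ) (a : En n) (t : ℝ), T.det ≠ 0 →
          (∀ x, f x ≤ Real.exp (t - ‖Matrix.toEuclideanLin T x + a‖)) →
          (∫ x, Real.exp (t₁ - ‖Matrix.toEuclideanLin T₁ x + a₁‖)) ≤
            ∫ x, Real.exp (t - ‖Matrix.toEuclideanLin T x + a‖)) →
        t₁ = t₀ ∧ ∃ O ∈ Matrix.orthogonalGroup (Fin n) ℝ,
          T₁ = O * T₀ ∧ a₁ = Matrix.toEuclideanLin O a₀) := by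
  obtain ⟨x₀, r, δ, hr, hδ, hball⟩ := hlc.exists_closedBall_le hnd
  obtain ⟨c, t', hc, hdecay⟩ := hlc.exists_le_exp hint hr hδ hball
  have hdet' : (c • (1 : Matrix (Fin n) (Fin n) ℝ)).det ≠ 0 := by
    simp [hc.ne']
  have hfeas' : ∀ x, f x ≤ Real.exp
      (t' - ‖Matrix.toEuclideanLin (c • (1 : Matrix (Fin n) (Fin n) ℝ)) x + -(c • x₀)‖) := by
    intro x
    rw [map_smul, Matrix.toLpLin_one, LinearMap.smul_apply, LinearMap.id_apply,
      ← sub_eq_add_neg, ← smul_sub, norm_smul, Real.norm_of_nonneg hc.le]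
    exact hdecay x
  obtain ⟨T₀, a₀, t₀, hT₀, hf₀, hmin₀⟩ :=
    exists_minimizer_of_closedBall hr hδ hball hdet' hfeas'
  refine ⟨T₀, a₀, t₀, hT₀, hf₀, fun T a t hT hTf => ?_, integral_exp_sub_norm T₀ a₀ t₀ hT₀,
    fun T₁ a₁ t₁ hT₁ hf₁ hmin₁ => ?_⟩
  · exact (integral_exp_sub_norm_le_iff _ _ _ _ hT₀ hT).2 (hmin₀ T a t hT hTf)
  have heq : Real.exp t₀ / |T₀.det| = Real.exp t₁ / |T₁.det| :=
    le_antisymm (hmin₀ T₁ a₁ t₁ hT₁ hf₁)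
      ((integral_exp_sub_norm_le_iff _ _ _ _ hT₁ hT₀).1 (hmin₁ T₀ a₀ t₀ hT₀ hf₀))
  obtain ⟨O₀, hO₀, P₀, b₀, hP₀, hTP₀, hab₀, hd₀, hn₀⟩ :=
    exists_orthogonal_posDef_representation T₀ a₀ hT₀
  obtain ⟨O₁, hO₁, P₁, b₁, hP₁, hTP₁, hab₁, hd₁, hn₁⟩ :=
    exists_orthogonal_posDef_representation T₁ a₁ hT₁
  obtain ⟨rfl, rfl, rfl⟩ := posDef_minimizer_unique hlc.1 hP₀ hP₁
    (fun x => by rw [← hn₀ x]; exact hf₀ x) (fun x => by rw [← hn₁ x]; exact hf₁ x)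
    (fun T a t hT hTf => by rw [← hd₀]; exact hmin₀ T a t hT hTf) (by rw [← hd₀, ← hd₁, heq])
  refine ⟨rfl, O₁ * star O₀, mul_mem hO₁ (Unitary.star_mem hO₀), ?_, ?_⟩
  · rw [hTP₁, hTP₀, Matrix.mul_assoc, ← Matrix.mul_assoc (star O₀),
      Unitary.star_mul_self_of_mem hO₀, one_mul]
  · rw [hab₁, hab₀, ← LinearMap.comp_apply, ← Matrix.toLpLin_mul_same, Matrix.mul_assoc,
      Unitary.star_mul_self_of_mem hO₀, mul_one]
end
end

section
/- Let K ⊂ ℝⁿ be a convex body whose Löwner ellipsoid (the unique ellipsoid of minimal volume containing K) is centered at the origin, and write the Löwner ellipsoid as T_{L(K)} B₂ⁿ for a linear map T_{L(K)}. Then the Löwner function of the characteristic function 𝟙_K is L(𝟙_K)(x) = e^{-n(‖T_{L(K)}^{-1} x‖₂ − 1)}; i.e., the pair (A₀, t₀) = (n·T_{L(K)}^{-1}, n) solves the minimization min{ ∫_{ℝⁿ} e^{-‖Ax‖₂+t} dx : A invertible affine, t ∈ ℝ, e^{-‖Ax‖₂+t} ≥ 𝟙_K }. -/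
open MeasureTheory Metric Set

noncomputable section

/-- Multiplying by `T⁻¹` after `T` is the identity on Euclidean space. -/
theorem toEuclideanLin_inv_apply {n : ℕ} (T : Matrix (Fin n) (Fin n) ℝ) (hT : IsUnit T.det)
    (x : En n) : Matrix.toEuclideanLin T⁻¹ (Matrix.toEuclideanLin T x) = x := by
  simp [Matrix.toLpLin_apply, Matrix.mulVec_mulVec, Matrix.nonsing_inv_mul T hT]

/-- Affine change of variables for integrals over Euclidean space. -/
theorem integral_comp_toEuclideanLin_add {n : ℕ} (T : Matrix (Fin n) (Fin n) ℝ) (hT : T.det ≠ 0)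
    (a : En n) (g : En n → ℝ) :
    ∫ x, g (Matrix.toEuclideanLin T x + a) = |T.det|⁻¹ * ∫ x, g x := by
  have hdet : LinearMap.det (Matrix.toEuclideanLin T) ≠ 0 := by rwa [LinearMap.det_toLpLin]
  let e : En n ≃ₗ[ℝ] En n := LinearMap.equivOfDetNeZero _ hdet
  have hemb : MeasurableEmbedding (Matrix.toEuclideanLin T) :=
    e.toContinuousLinearEquiv.toHomeomorph.measurableEmbedding
  have h := hemb.integral_map (μ := volume) (fun y => g (y + a))
  rw [← h, Measure.map_linearMap_addHaar_eq_smul_addHaar volume hdet, integral_smul_measure,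
    integral_add_right_eq_self g a, LinearMap.det_toLpLin, ENNReal.toReal_ofReal (abs_nonneg _),
    abs_inv, smul_eq_mul]

/-- The tangent-line bound for `exp` at `n` on the scale of `n`-th powers. -/
theorem pow_div_le_exp_sub (n : ℕ) {t : ℝ} (ht : 0 ≤ t) :
    t ^ n * Real.exp n ≤ (n : ℝ) ^ n * Real.exp t := by
  rcases Nat.eq_zero_or_pos n with rfl | hn
  · simpa using ht
  have hn' : (0 : ℝ) < n := by exact_mod_cast hn
  have h : t / n * Real.exp 1 ≤ Real.exp (t / n) := by
    have := Real.add_one_le_exp (t / n - 1)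
    rw [Real.exp_sub, le_div_iff₀ (Real.exp_pos 1)] at this
    linarith
  have h2 := pow_le_pow_left₀ (by positivity) h n
  rw [mul_pow, ← Real.exp_nat_mul, ← Real.exp_nat_mul, mul_one, mul_div_cancel₀ t hn'.ne',
    div_pow, div_mul_eq_mul_div, div_le_iff₀ (by positivity)] at h2
  linarith

/-- If `‖T x + a‖ ≤ t` on `K`, minimality of the ellipsoid `TL B₂ⁿ` bounds
`|det TL| |det T|` by `tⁿ`. -/
theorem abs_det_mul_abs_det_le_pow {n : ℕ} {K : Set (En n)} {TL : Matrix (Fin n) (Fin n) ℝ}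
    (hmin : ∀ (S : Matrix (Fin n) (Fin n) ℝ) (c : En n), S.det ≠ 0 →
      K ⊆ (fun x => Matrix.toEuclideanLin S x + c) '' closedBall (0 : En n) 1 →
      |TL.det| ≤ |S.det|)
    {T : Matrix (Fin n) (Fin n) ℝ} (hT : T.det ≠ 0) {a : En n} {t : ℝ} (ht : 0 ≤ t)
    (hK : ∀ x ∈ K, ‖Matrix.toEuclideanLin T x + a‖ ≤ t) :
    |TL.det| * |T.det| ≤ t ^ n := by
  have key : ∀ s, t < s → |TL.det| * |T.det| ≤ s ^ n := by
    intro s hs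
    have hs0 : 0 < s := ht.trans_lt hs
    have hdet : (s • T⁻¹).det = s ^ n * T.det⁻¹ := by
      rw [Matrix.det_smul, Fintype.card_fin, Matrix.det_nonsing_inv, Ring.inverse_eq_inv']
    have h := hmin (s • T⁻¹) (-Matrix.toEuclideanLin T⁻¹ a)
      (by rw [hdet]; exact mul_ne_zero (by positivity) (inv_ne_zero hT)) (by
        intro x hx
        refine ⟨s⁻¹ • (Matrix.toEuclideanLin T x + a), ?_, ?_⟩
        · rw [mem_closedBall_zero_iff, norm_smul, Real.norm_of_nonneg (by positivity),
            inv_mul_le_iff₀ hs0, mul_one]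
          exact (hK x hx).trans hs.le
        · simp only [map_smul, LinearMap.smul_apply, map_add,
            toEuclideanLin_inv_apply T hT.isUnit]
          rw [← smul_add, smul_smul, inv_mul_cancel₀ hs0.ne', one_smul, add_neg_cancel_right])
    rw [hdet, abs_mul, abs_inv, abs_of_pos (pow_pos hs0 n), ← div_eq_mul_inv,
      le_div_iff₀ (abs_pos.mpr hT)] at h
    exact h
  have hlim : Filter.Tendsto (fun s : ℝ => s ^ n) (nhdsWithin t (Ioi t)) (nhds (t ^ n)) :=
    ((continuous_pow n).tendsto t).mono_left nhdsWithin_le_nhds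
  exact ge_of_tendsto hlim (Filter.eventually_of_mem self_mem_nhdsWithin key)

/-- if the Löwner ellipsoid of a convex body `K` is `T_L B₂ⁿ`,
centered at the origin, then the pair `(n • T_L⁻¹, n)` solves the Löwner-function
minimization problem for the characteristic function `𝟙_K`, i.e.
`L(𝟙_K)(x) = e^{-n(‖T_L⁻¹ x‖ - 1)}`. -/
theorem lowner_function_of_convex_body {n : ℕ}
    (K : Set (En n)) (hKconv : Convex ℝ K) (hKcomp : IsCompact K)
    (hKint : (interior K).Nonempty)
    (TL : Matrix (Fin n) (Fin n) ℝ) (hTL : IsUnit TL)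
    -- `TL B₂ⁿ` contains `K` (the Löwner ellipsoid, centered at `0`)
    (hcont : K ⊆ Matrix.toEuclideanLin TL '' closedBall (0 : En n) 1)
    -- and it has minimal volume among all ellipsoids (affine images of the ball) containing `K`
    (hmin : ∀ (S : Matrix (Fin n) (Fin n) ℝ) (c : En n), S.det ≠ 0 →
      K ⊆ (fun x => Matrix.toEuclideanLin S x + c) '' closedBall (0 : En n) 1 →
      |TL.det| ≤ |S.det|) :
    -- the pair `(A₀, t₀) = (n·TL⁻¹, n)` majorizes `𝟙_K` …
    (∀ x, K.indicator (fun _ => (1 : ℝ)) x ≤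
        Real.exp ((n : ℝ) - ‖Matrix.toEuclideanLin ((n : ℝ) • TL⁻¹) x‖)) ∧
    -- … and minimizes the integral among all majorizing "ellipsoidal" functions
    (∀ (T : Matrix (Fin n) (Fin n) ℝ) (a : En n) (t : ℝ), T.det ≠ 0 →
      (∀ x, K.indicator (fun _ => (1 : ℝ)) x ≤
          Real.exp (t - ‖Matrix.toEuclideanLin T x + a‖)) →
      (∫ x, Real.exp ((n : ℝ) - ‖Matrix.toEuclideanLin ((n : ℝ) • TL⁻¹) x‖)) ≤
        ∫ x, Real.exp (t - ‖Matrix.toEuclideanLin T x + a‖)) ∧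
    -- so that the Löwner function of `𝟙_K` is `x ↦ e^{-n(‖TL⁻¹x‖-1)}`
    (∀ x : En n, Real.exp ((n : ℝ) - ‖Matrix.toEuclideanLin ((n : ℝ) • TL⁻¹) x‖) =
      Real.exp (-(n : ℝ) * (‖Matrix.toEuclideanLin TL⁻¹ x‖ - 1))) := by
  have hdetL : TL.det ≠ 0 := ((Matrix.isUnit_iff_isUnit_det TL).mp hTL).ne_zero
  have hnorm : ∀ x : En n, ‖Matrix.toEuclideanLin ((n : ℝ) • TL⁻¹) x‖ =
      n * ‖Matrix.toEuclideanLin TL⁻¹ x‖ := by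
    intro x
    rw [map_smul, LinearMap.smul_apply, norm_smul, Real.norm_of_nonneg n.cast_nonneg]
  refine ⟨fun x => ?_, fun T a t hT hmaj => ?_, fun x => ?_⟩
  · by_cases hx : x ∈ K
    swap
    · rw [indicator_of_notMem hx]
      exact (Real.exp_pos _).le
    rw [indicator_of_mem hx]
    obtain ⟨y, hy, rfl⟩ := hcont hx
    rw [mem_closedBall_zero_iff] at hy
    rw [Real.one_le_exp_iff, hnorm, toEuclideanLin_inv_apply TL hdetL.isUnit, sub_nonneg]
    exact mul_le_of_le_one_right n.cast_nonneg hy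
  · have hK : ∀ x ∈ K, ‖Matrix.toEuclideanLin T x + a‖ ≤ t := by
      intro x hx
      have h := hmaj x
      rwa [indicator_of_mem hx, Real.one_le_exp_iff, sub_nonneg] at h
    obtain ⟨x₀, hx₀⟩ := hKint
    have ht : 0 ≤ t := (norm_nonneg _).trans (hK x₀ (interior_subset hx₀))
    have hdet : ((n : ℝ) • TL⁻¹).det = (n : ℝ) ^ n * TL.det⁻¹ := by
      rw [Matrix.det_smul, Fintype.card_fin, Matrix.det_nonsing_inv, Ring.inverse_eq_inv']
    have hnn : (0 : ℝ) < (n : ℝ) ^ n := by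
      rcases Nat.eq_zero_or_pos n with rfl | hn
      · simp
      · have : (0 : ℝ) < n := by exact_mod_cast hn
        positivity
    have hI₁ := integral_comp_toEuclideanLin_add ((n : ℝ) • TL⁻¹)
      (by rw [hdet]; exact mul_ne_zero hnn.ne' (inv_ne_zero hdetL)) 0
      (fun y => Real.exp ((n : ℝ) - ‖y‖))
    have hI₂ := integral_comp_toEuclideanLin_add T hT a (fun y => Real.exp (t - ‖y‖))
    have hexp : ∀ s : ℝ, ∫ y : En n, Real.exp (s - ‖y‖) =
        Real.exp s * ∫ y : En n, Real.exp (-‖y‖) := by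
      intro s
      rw [← integral_const_mul]
      simp_rw [sub_eq_add_neg, Real.exp_add]
    simp only [add_zero] at hI₁
    rw [hI₁, hI₂, hexp, hexp, hdet, ← mul_assoc, ← mul_assoc]
    refine mul_le_mul_of_nonneg_right ?_ (integral_nonneg fun y => (Real.exp_pos _).le)
    rw [abs_mul, abs_inv, abs_of_pos hnn, mul_inv, inv_inv]
    have hT' : 0 < |T.det| := abs_pos.mpr hT
    have hdets := abs_det_mul_abs_det_le_pow hmin hT ht hK
    rw [inv_mul_eq_div |T.det|, le_div_iff₀ hT', mul_assoc, mul_assoc, inv_mul_le_iff₀ hnn]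
    calc |TL.det| * (Real.exp n * |T.det|) = |TL.det| * |T.det| * Real.exp n := by ring
      _ ≤ t ^ n * Real.exp n := mul_le_mul_of_nonneg_right hdets (Real.exp_pos _).le
      _ ≤ (n : ℝ) ^ n * Real.exp t := pow_div_le_exp_sub n ht
  · rw [hnorm]
    ring_nf
end
end

section
/- The Löwner function of the Gaussian g(x) = e^{-‖x‖₂²/2} on ℝⁿ is L(g)(x) = e^{-√n·‖x‖₂ + n/2}; i.e., the pair (A₀, t₀) = (√n·Id, n/2) satisfies e^{-√n‖x‖₂ + n/2} ≥ e^{-‖x‖₂²/2} for all x and minimizes ∫_{ℝⁿ} e^{-‖Ax‖₂+t} dx among all pairs (A, t) with A an invertible affine map, t ∈ ℝ, and e^{-‖Ax‖₂+t} ≥ g pointwise. -/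
open MeasureTheory Metric Set

noncomputable section

/-- `x ↦ e^{-‖x‖}` is integrable on a finite-dimensional space. -/
theorem integrable_exp_neg_norm {E : Type*} [NormedAddCommGroup E] [NormedSpace ℝ E]
    [FiniteDimensional ℝ E] [MeasurableSpace E] [BorelSpace E] (μ : Measure E)
    [μ.IsAddHaarMeasure] : Integrable (fun x : E => Real.exp (-‖x‖)) μ := by
  set m := Module.finrank ℝ E + 1
  have hm : (Module.finrank ℝ E : ℝ) < (m : ℝ) := by exact_mod_cast Nat.lt_succ_self _
  refine ((integrable_one_add_norm (μ := μ) hm).const_mul (Real.exp 1 * m.factorial)).mono'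
    (by fun_prop) (Filter.Eventually.of_forall fun x => ?_)
  have h1 : (0 : ℝ) < 1 + ‖x‖ := by positivity
  have h := Real.pow_div_factorial_le_exp (1 + ‖x‖) h1.le m
  rw [div_le_iff₀ (by positivity), Real.exp_add] at h
  rw [Real.norm_of_nonneg (Real.exp_pos _).le, Real.rpow_neg h1.le, Real.rpow_natCast,
    ← div_eq_mul_inv, le_div_iff₀ (by positivity), Real.exp_neg, inv_mul_le_iff₀ (by positivity)]
  linarith

/-- `x ↦ e^{-‖T x‖}` is integrable for an injective linear map `T`. -/
theorem integrable_exp_neg_norm_linearMap {E F : Type*} [NormedAddCommGroup E] [NormedSpace ℝ E]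
    [FiniteDimensional ℝ E] [MeasurableSpace E] [BorelSpace E] [NormedAddCommGroup F]
    [NormedSpace ℝ F] (μ : Measure E) [μ.IsAddHaarMeasure] {T : E →ₗ[ℝ] F}
    (hT : Function.Injective T) : Integrable (fun x : E => Real.exp (-‖T x‖)) μ := by
  obtain ⟨K, hK, hKT⟩ := T.exists_antilipschitzWith (LinearMap.ker_eq_bot.2 hT)
  have hK' : (0 : ℝ) < K := hK
  have hcont : Continuous T := T.continuous_of_finiteDimensional
  refine ((integrable_exp_neg_norm μ).comp_smul (inv_ne_zero hK'.ne')).mono'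
    (by fun_prop) (Filter.Eventually.of_forall fun x => ?_)
  have h := hKT.le_mul_dist x 0
  rw [map_zero, dist_zero_right, dist_zero_right] at h
  rw [Real.norm_of_nonneg (Real.exp_pos _).le, norm_smul, norm_inv, Real.norm_of_nonneg hK'.le,
    Real.exp_le_exp, neg_le_neg_iff, inv_mul_le_iff₀ hK']
  exact h

theorem integral_exp_neg_const_mul_norm {n : ℕ} {c : ℝ} (hc : 0 ≤ c) :
    ∫ x : En n, Real.exp (-(c * ‖x‖)) = (c ^ n)⁻¹ * ∫ x : En n, Real.exp (-‖x‖) := by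
  have h := Measure.integral_comp_smul (volume : Measure (En n)) (fun x => Real.exp (-‖x‖)) c
  simp only [norm_smul, Real.norm_of_nonneg hc, finrank_euclideanSpace, Fintype.card_fin,
    smul_eq_mul, abs_of_nonneg (inv_nonneg.2 (pow_nonneg hc n))] at h
  exact h

/-- If `‖T x + a‖ ≤ t + ‖x‖² / 2` everywhere, then the operator
norm of `T` is at most `√(2t)`. -/
theorem norm_le_sqrt_mul_norm_of_norm_add_le {E F : Type*} [NormedAddCommGroup E]
    [NormedSpace ℝ E] [NormedAddCommGroup F] [NormedSpace ℝ F] {T : E →ₗ[ℝ] F} {a : F} {t : ℝ}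
    (h : ∀ x, ‖T x + a‖ ≤ t + ‖x‖ ^ 2 / 2) (x : E) : ‖T x‖ ≤ Real.sqrt (2 * t) * ‖x‖ := by
  have hsymm (y : E) : ‖T y‖ ≤ t + ‖y‖ ^ 2 / 2 := by
    have h1 := h y
    have h2 := h (-y)
    rw [map_neg, norm_neg] at h2
    have h3 := norm_sub_le (T y + a) (-T y + a)
    rw [show T y + a - (-T y + a) = (2 : ℝ) • T y by rw [two_smul]; abel, norm_smul,
      Real.norm_ofNat] at h3
    linarith
  have hquad (r : ℝ) : 0 ≤ ‖x‖ ^ 2 / 2 * (r * r) + -‖T x‖ * r + t := by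
    have h1 := hsymm (r • x)
    rw [map_smul, norm_smul, norm_smul, Real.norm_eq_abs, mul_pow, sq_abs] at h1
    nlinarith [mul_le_mul_of_nonneg_right (le_abs_self r) (norm_nonneg (T x))]
  have hd := discrim_le_zero hquad
  have ht : 0 ≤ t := by simpa using (norm_nonneg _).trans (hsymm 0)
  rw [discrim] at hd
  refine abs_le_of_sq_le_sq' ?_ (by positivity) |>.2
  rw [mul_pow, Real.sq_sqrt (by positivity)]
  linarith

/-- The scalar optimization behind the minimality of the Löwner function of the Gaussian. -/
theorem exp_mul_sqrt_pow_le (n : ℕ) {t : ℝ} (ht : 0 ≤ t) :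
    Real.exp (n / 2) * Real.sqrt (2 * t) ^ n ≤ Real.exp t * Real.sqrt n ^ n := by
  rcases Nat.eq_zero_or_pos n with rfl | hn
  · simpa using ht
  have hn' : (0 : ℝ) < n := by exact_mod_cast hn
  have key : Real.sqrt (2 * t) ≤ Real.sqrt n * Real.exp (t / n - 1 / 2) := by
    refine Real.sqrt_le_iff.2 ⟨by positivity, ?_⟩
    rw [mul_pow, Real.sq_sqrt hn'.le, ← Real.exp_nat_mul, ← div_le_iff₀' hn']
    have h := Real.add_one_le_exp (((2 : ℕ) : ℝ) * (t / n - 1 / 2))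
    refine le_trans (le_of_eq ?_) h
    push_cast
    ring
  calc Real.exp (n / 2) * Real.sqrt (2 * t) ^ n
      ≤ Real.exp (n / 2) * (Real.sqrt n * Real.exp (t / n - 1 / 2)) ^ n := by gcongr
    _ = Real.exp t * Real.sqrt n ^ n := by
        rw [mul_pow, ← Real.exp_nat_mul, mul_left_comm, ← Real.exp_add, mul_comm]
        congr 2
        field_simp
        ring

/-- the Löwner function of the Gaussian `g(x) = e^{-‖x‖²/2}` is
`L(g)(x) = e^{-√n ‖x‖ + n/2}`; i.e. the pair `(√n • Id, n/2)` majorizes `g` and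
minimizes the integral among all majorizing ellipsoidal functions. -/
theorem lowner_function_of_gaussian {n : ℕ} :
    -- `e^{-√n‖x‖ + n/2} ≥ e^{-‖x‖²/2}` for all `x`
    (∀ x : En n, Real.exp (-‖x‖ ^ 2 / 2) ≤
        Real.exp ((n : ℝ) / 2 - Real.sqrt n * ‖x‖)) ∧
    -- minimality among all majorizing pairs `(A, t)` with `A` an invertible affine map
    (∀ (T : Matrix (Fin n) (Fin n) ℝ) (a : En n) (t : ℝ), T.det ≠ 0 →
      (∀ x : En n, Real.exp (-‖x‖ ^ 2 / 2) ≤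
          Real.exp (t - ‖Matrix.toEuclideanLin T x + a‖)) →
      (∫ x : En n, Real.exp ((n : ℝ) / 2 - Real.sqrt n * ‖x‖)) ≤
        ∫ x : En n, Real.exp (t - ‖Matrix.toEuclideanLin T x + a‖)) := by
  refine ⟨fun x => Real.exp_le_exp.2 ?_, fun T a t hdet hmaj => ?_⟩
  · nlinarith [sq_nonneg (‖x‖ - Real.sqrt n), Real.sq_sqrt (Nat.cast_nonneg (α := ℝ) n)]
  have hbound : ∀ x : En n, ‖Matrix.toEuclideanLin T x + a‖ ≤ t + ‖x‖ ^ 2 / 2 := fun x => by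
    linarith [Real.exp_le_exp.1 (hmaj x)]
  have hnorm := norm_le_sqrt_mul_norm_of_norm_add_le hbound
  have ht : 0 ≤ t := by simpa using (norm_nonneg _).trans (hbound 0)
  have hunit : IsUnit T.det := isUnit_iff_ne_zero.2 hdet
  have hinj : Function.Injective (Matrix.toEuclideanLin T) := fun x y hxy => by
    have h := congrArg (Matrix.toEuclideanLin T⁻¹) hxy
    simpa [Matrix.toLpLin_apply, Matrix.mulVec_mulVec, Matrix.nonsing_inv_mul T hunit]
      using h
  obtain ⟨b, rfl⟩ : ∃ b, Matrix.toEuclideanLin T b = a :=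
    ⟨Matrix.toEuclideanLin T⁻¹ a, by
      simp [Matrix.toLpLin_apply, Matrix.mulVec_mulVec, Matrix.mul_nonsing_inv T hunit]⟩
  have hpos : 0 < Real.sqrt (2 * t) ^ n := by
    rcases Nat.eq_zero_or_pos n with rfl | hn
    · simp
    refine pow_pos ((Real.sqrt_nonneg _).lt_of_ne fun h0 => ?_) n
    have : Nonempty (Fin n) := ⟨⟨0, hn⟩⟩
    obtain ⟨x, hx⟩ := exists_ne (0 : En n)
    have hTx := hnorm x
    rw [← h0, zero_mul, norm_le_zero_iff] at hTx
    exact hx (hinj (hTx.trans (map_zero _).symm))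
  have hnpos : 0 < Real.sqrt n ^ n := by
    rcases Nat.eq_zero_or_pos n with rfl | hn
    · simp
    · positivity
  have hI : 0 ≤ ∫ x : En n, Real.exp (-‖x‖) := integral_nonneg fun x => (Real.exp_pos _).le
  calc ∫ x : En n, Real.exp ((n : ℝ) / 2 - Real.sqrt n * ‖x‖)
      = Real.exp (n / 2) * (Real.sqrt n ^ n)⁻¹ * ∫ x : En n, Real.exp (-‖x‖) := by
        simp_rw [sub_eq_add_neg, Real.exp_add]
        rw [integral_const_mul, integral_exp_neg_const_mul_norm (Real.sqrt_nonneg _), mul_assoc]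
    _ ≤ Real.exp t * (Real.sqrt (2 * t) ^ n)⁻¹ * ∫ x : En n, Real.exp (-‖x‖) := by
        refine mul_le_mul_of_nonneg_right ?_ hI
        rw [← div_eq_mul_inv, ← div_eq_mul_inv, div_le_div_iff₀ hnpos hpos]
        exact exp_mul_sqrt_pow_le n ht
    _ = Real.exp t * ∫ x : En n, Real.exp (-(Real.sqrt (2 * t) * ‖x‖)) := by
        rw [integral_exp_neg_const_mul_norm (Real.sqrt_nonneg _), mul_assoc]
    _ ≤ Real.exp t * ∫ x : En n, Real.exp (-‖Matrix.toEuclideanLin T x‖) := by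
        refine mul_le_mul_of_nonneg_left (integral_mono_of_nonneg
          (Filter.Eventually.of_forall fun x => (Real.exp_pos _).le)
          (integrable_exp_neg_norm_linearMap volume hinj)
          (Filter.Eventually.of_forall fun x => ?_)) (Real.exp_pos _).le
        exact Real.exp_le_exp.2 (neg_le_neg (hnorm x))
    _ = ∫ x : En n, Real.exp (t - ‖Matrix.toEuclideanLin T x + Matrix.toEuclideanLin T b‖) := by
        simp_rw [sub_eq_add_neg, Real.exp_add, ← map_add]
        rw [integral_const_mul,
          integral_add_right_eq_self fun x => Real.exp (-‖Matrix.toEuclideanLin T x‖)]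
end
end

section
/- Fix b ∈ ℝⁿ and let f = e^{-ψ} be a nondegenerate integrable log-concave function on ℝⁿ. Then there exists a solution (T₀, t₀), with T₀ a symmetric positive definite matrix and t₀ ∈ ℝ, to the maximization problem: maximize e^{-t}·det T over all symmetric positive definite matrices T and all t ∈ ℝ subject to ‖Tx‖₂ − t ≤ ψ(x − b) for all x ∈ ℝⁿ; and this solution is unique up to left composition of T₀ with an orthogonal transformation. -/
open MeasureTheory Metric Set

noncomputable section

namespace Matrix

variable {ι : Type*} [Fintype ι] [DecidableEq ι]

theorem IsHermitian.det_half_smul_one_add {C : Matrix ι ι ℝ} (hC : C.IsHermitian) :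
    ((1 / 2 : ℝ) • (1 + C)).det = ∏ i, (1 + hC.eigenvalues i) / 2 := by
  set U := hC.eigenvectorUnitary
  have hU : U.1 * star U.1 = 1 := Unitary.mul_star_self_of_mem U.2
  have h : (1 / 2 : ℝ) • (1 + C) =
      U.1 * diagonal (fun i => (1 + hC.eigenvalues i) / 2) * star U.1 := by
    have hd : diagonal (fun i => (1 + hC.eigenvalues i) / 2) =
        (1 / 2 : ℝ) • (1 + diagonal (RCLike.ofReal ∘ hC.eigenvalues) : Matrix ι ι ℝ) := by
      rw [← diagonal_one, diagonal_add, ← diagonal_smul]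
      congr 1
      ext i
      simp
      ring
    have hs := hC.spectral_theorem
    rw [Unitary.conjStarAlgAut_apply] at hs
    rw [hd, mul_smul_comm, smul_mul_assoc, mul_add, add_mul, ← hs, mul_one, hU]
  rw [h, det_mul, det_mul, mul_right_comm, ← det_mul, hU, det_one,
    one_mul, det_diagonal]

theorem PosDef.eq_one_of_det_half_smul_one_add_sq_le {C : Matrix ι ι ℝ} (hC : C.PosDef)
    (h : ((1 / 2 : ℝ) • (1 + C)).det ^ 2 ≤ C.det) : C = 1 := by
  have hev : hC.isHermitian.eigenvalues = fun _ => 1 := by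
    ext j
    by_contra hj
    refine h.not_gt ?_
    rw [hC.isHermitian.det_half_smul_one_add, hC.isHermitian.det_eq_prod_eigenvalues,
      ← Finset.prod_pow]
    refine Finset.prod_lt_prod (fun i _ => hC.eigenvalues_pos i) (fun i _ => ?_)
      ⟨j, Finset.mem_univ j, ?_⟩ <;> simp only [RCLike.ofReal_real_eq_id, id_eq]
    · nlinarith [sq_nonneg (1 - hC.isHermitian.eigenvalues i)]
    · have : 0 < (1 - hC.isHermitian.eigenvalues j) ^ 2 :=
        sq_pos_of_ne_zero (sub_ne_zero.2 (Ne.symm hj))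
      nlinarith
  have hs := hC.isHermitian.spectral_theorem
  rw [hs, hev]
  have : diagonal (RCLike.ofReal ∘ fun _ => (1 : ℝ)) = (1 : Matrix ι ι ℝ) := by
    rw [← diagonal_one]; rfl
  rw [this, map_one]

theorem PosDef.exists_congruence_one {A B : Matrix ι ι ℝ} (hA : A.PosDef) (hB : B.PosDef) :
    ∃ S C : Matrix ι ι ℝ, S.det ≠ 0 ∧ C.PosDef ∧ A = star S * S ∧ B = star S * C * S := by
  open scoped MatrixOrder in
  obtain ⟨S, hS⟩ := CStarAlgebra.nonneg_iff_eq_star_mul_self.mp hA.posSemidef.nonneg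
  have hSd : S.det ≠ 0 := by
    intro h0
    have := hA.det_pos
    rw [hS, det_mul, h0, mul_zero] at this
    exact this.false
  have hSu : IsUnit S := (isUnit_iff_isUnit_det S).2 hSd.isUnit
  have hB' : B = star S * (star S⁻¹ * B * S⁻¹) * S := by
    have h1 : S⁻¹ * S = 1 := nonsing_inv_mul _ hSd.isUnit
    have h2 : star S * star S⁻¹ = 1 := by rw [← star_mul, h1, star_one]
    calc B = (star S * star S⁻¹) * B * (S⁻¹ * S) := by rw [h1, h2, one_mul, mul_one]
      _ = _ := by noncomm_ring
  refine ⟨S, star S⁻¹ * B * S⁻¹, hSd, ?_, hS, hB'⟩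
  rw [hB'] at hB
  exact (IsUnit.posDef_star_left_conjugate_iff hSu).1 hB

theorem half_smul_congruence_add (S C : Matrix ι ι ℝ) :
    (1 / 2 : ℝ) • (star S * S + star S * C * S) = star S * ((1 / 2 : ℝ) • (1 + C)) * S := by
  rw [mul_smul_comm, smul_mul_assoc, mul_add, add_mul, mul_one]

theorem PosDef.eq_of_det_half_smul_add_sq_le {A B : Matrix ι ι ℝ} (hA : A.PosDef)
    (hB : B.PosDef) (h : ((1 / 2 : ℝ) • (A + B)).det ^ 2 ≤ A.det * B.det) : A = B := by
  obtain ⟨S, C, hS, hC, rfl, rfl⟩ := hA.exists_congruence_one hB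
  have hC1 : C = 1 := by
    refine hC.eq_one_of_det_half_smul_one_add_sq_le ?_
    have hA' := hA.det_pos
    rw [half_smul_congruence_add] at h
    simp only [det_mul] at h hA'
    refine le_of_mul_le_mul_left ?_ (pow_pos hA' 2)
    linarith
  rw [hC1, mul_one]

end Matrix

theorem Convex.isBounded_of_measure_lt_top {E : Type*} [NormedAddCommGroup E] [NormedSpace ℝ E]
    [FiniteDimensional ℝ E] [MeasurableSpace E] [BorelSpace E] {μ : Measure E}
    [μ.IsAddHaarMeasure] {C : Set E} (hC : Convex ℝ C) (hμ : μ C < ⊤) {x₀ : E} {r : ℝ}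
    (hr : 0 < r) (hball : ball x₀ r ⊆ C) : Bornology.IsBounded C := by
  have : IsFiniteMeasure (μ.restrict C) := ⟨by simpa using hμ⟩
  have := FiniteDimensional.proper ℝ E
  have htight := tendsto_measure_compl_closedBall_of_isTightMeasureSet
    (isTightMeasureSet_singleton (μ := μ.restrict C)) x₀
  simp only [mem_singleton_iff, iSup_iSup_eq_left] at htight
  have hpos : 0 < μ (ball x₀ (r / 2)) := measure_ball_pos μ x₀ (half_pos hr)
  obtain ⟨R, hR, hR0⟩ :=
    ((htight.eventually (gt_mem_nhds hpos)).and (Filter.eventually_gt_atTop 0)).exists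
  refine isBounded_iff_subset_closedBall x₀ |>.2 ⟨2 * R + r, fun y hy => ?_⟩
  by_contra hyR
  simp only [mem_closedBall, not_le, dist_eq_norm] at hyR
  set z : E := (1 / 2 : ℝ) • (x₀ + y) with hz
  have hsub : ball z (r / 2) ⊆ C ∩ (closedBall x₀ R)ᶜ := by
    intro w hw
    rw [mem_ball, dist_eq_norm] at hw
    constructor
    · have h1 : x₀ + (2 : ℝ) • (w - z) ∈ C := by
        apply hball
        rw [mem_ball, dist_eq_norm, add_sub_cancel_left, norm_smul, Real.norm_ofNat]
        linarith
      have h2 := hC h1 hy (a := 1 / 2) (b := 1 / 2) (by norm_num) (by norm_num) (by norm_num)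
      convert h2 using 1
      rw [hz]
      module
    · simp only [mem_compl_iff, mem_closedBall, not_le, dist_eq_norm]
      have h3 : y - x₀ = (2 : ℝ) • (w - x₀) - (2 : ℝ) • (w - z) := by rw [hz]; module
      have h4 : ‖y - x₀‖ ≤ 2 * ‖w - x₀‖ + 2 * ‖w - z‖ := by
        rw [h3]
        refine (norm_sub_le _ _).trans ?_
        simp [norm_smul]
      linarith
  have hle : μ (ball x₀ (r / 2)) ≤ μ.restrict C (closedBall x₀ R)ᶜ := by
    rw [Measure.restrict_apply measurableSet_closedBall.compl, inter_comm,
      Measure.addHaar_ball_center, ← Measure.addHaar_ball_center μ z]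
    exact measure_mono hsub
  exact (hle.trans_lt hR).false

namespace LogConcaveFn

variable {n : ℕ} {f : En n → ℝ}

theorem convex_superlevel (hf : LogConcaveFn f) {m : ℝ} (hm : 0 < m) :
    Convex ℝ {x | m ≤ f x} := by
  intro x hx y hy a b ha hb hab
  obtain rfl : b = 1 - a := by linarith
  refine le_trans ?_ (hf.2 x y a ha (by linarith))
  calc m = m ^ a * m ^ (1 - a) := by rw [← Real.rpow_add hm]; simp
    _ ≤ _ := mul_le_mul (Real.rpow_le_rpow hm.le hx ha) (Real.rpow_le_rpow hm.le hy hb)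
      (by positivity) (Real.rpow_nonneg (hf.1 x) _)

theorem concaveOn_log (hf : LogConcaveFn f) :
    ConcaveOn ℝ {x | 0 < f x} fun x => Real.log (f x) := by
  have key : ∀ x y, 0 < f x → 0 < f y → ∀ a : ℝ, 0 ≤ a → a ≤ 1 →
      0 < f x ^ a * f y ^ (1 - a) := fun x y hx hy a _ _ => by positivity
  refine ⟨fun x hx y hy a b ha hb hab => ?_, fun x hx y hy a b ha hb hab => ?_⟩ <;>
    obtain rfl : b = 1 - a := by linarith
  · exact (key x y hx hy a ha (by linarith)).trans_le (hf.2 x y a ha (by linarith))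
  · have h := Real.log_le_log (key x y hx hy a ha (by linarith)) (hf.2 x y a ha (by linarith))
    rwa [Real.log_mul (Real.rpow_pos_of_pos hx _).ne' (Real.rpow_pos_of_pos hy _).ne',
      Real.log_rpow hx, Real.log_rpow hy] at h

theorem exists_ball_lower_bound (hf : LogConcaveFn f) (hnd : (interior {x | 0 < f x}).Nonempty) :
    ∃ x₀ : En n, ∃ r > 0, ∃ m > 0, ∀ x ∈ ball x₀ r, m ≤ f x := by
  obtain ⟨x₀, hx₀⟩ := hnd
  have hcont := hf.concaveOn_log.continuousOn_interior.continuousAt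
    (isOpen_interior.mem_nhds hx₀)
  have hev := (hcont.eventually (lt_mem_nhds (sub_one_lt (Real.log (f x₀))))).and
    (isOpen_interior.mem_nhds hx₀)
  obtain ⟨r, hr, h⟩ := Metric.eventually_nhds_iff_ball.1 hev
  refine ⟨x₀, r, hr, Real.exp (Real.log (f x₀) - 1), Real.exp_pos _, fun x hx => ?_⟩
  have hpos : x ∈ {x | 0 < f x} := interior_subset (h x hx).2
  exact (Real.le_log_iff_exp_le hpos).1 (h x hx).1.le

theorem exists_upper_bound_on_ball (hf : LogConcaveFn f) {x₀ : En n} {r m : ℝ} (hr : 0 < r)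
    (hm : 0 < m) (hball : ∀ x ∈ ball x₀ r, m ≤ f x) {R : ℝ} (hR : 0 < R) :
    ∃ B, ∀ x ∈ closedBall x₀ R, f x ≤ B := by
  set θ : ℝ := r / (2 * R) with hθ
  have hθ0 : 0 < θ := by positivity
  set l : ℝ := θ / (1 + θ) with hl
  have hl0 : 0 < l := by positivity
  have hl1 : 1 - l = 1 / (1 + θ) := by rw [hl]; field_simp; ring
  refine ⟨(f x₀ / m ^ (1 - l)) ^ l⁻¹, fun y hy => ?_⟩
  set z : En n := x₀ - θ • (y - x₀) with hz
  have hzb : z ∈ ball x₀ r := by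
    rw [mem_closedBall, dist_eq_norm] at hy
    rw [mem_ball, dist_eq_norm, hz, sub_sub_cancel_left, norm_neg, norm_smul, Real.norm_eq_abs,
      abs_of_pos hθ0]
    calc θ * ‖y - x₀‖ ≤ θ * R := by gcongr
      _ = r / 2 := by rw [hθ]; field_simp
      _ < r := by linarith
  have hcomb : l • y + (1 - l) • z = x₀ := by
    have h1 : (1 - l) * θ = l := by rw [hl1, hl]; ring
    rw [hz, smul_sub, smul_smul, h1]
    module
  have h := hf.2 y z l hl0.le (by have : 0 < 1 - l := hl1 ▸ (by positivity); linarith)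
  rw [hcomb] at h
  rw [Real.le_rpow_inv_iff_of_pos (hf.1 y) (div_nonneg (hf.1 _) (by positivity)) hl0,
    le_div_iff₀ (by positivity)]
  refine le_trans ?_ h
  have hl1' : 0 ≤ 1 - l := hl1 ▸ (by positivity)
  exact mul_le_mul_of_nonneg_left (Real.rpow_le_rpow hm.le (hball z hzb) hl1')
    (Real.rpow_nonneg (hf.1 y) _)

theorem exists_exponential_decay (hf : LogConcaveFn f) (hint : Integrable f)
    (hnd : (interior {x | 0 < f x}).Nonempty) :
    ∃ c > 0, ∃ s : ℝ, ∀ x, f x ≤ Real.exp (s - c * ‖x‖) := by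
  obtain ⟨x₀, r, hr, m, hm, hball⟩ := hf.exists_ball_lower_bound hnd
  set a : ℝ := Real.log m with ha
  have hbdd : Bornology.IsBounded {x | Real.exp (a - 1) ≤ f x} := by
    refine (hf.convex_superlevel (Real.exp_pos _)).isBounded_of_measure_lt_top (μ := volume) (x₀ := x₀)
      (hint.measure_ge_lt_top (Real.exp_pos _)) hr fun x hx => ?_
    refine le_trans ?_ (hball x hx)
    calc Real.exp (a - 1) ≤ Real.exp a := Real.exp_le_exp.2 (by linarith)
      _ = m := Real.exp_log hm
  obtain ⟨R, hR0, hR⟩ := hbdd.subset_closedBall_lt 0 x₀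
  obtain ⟨B, hB⟩ := hf.exists_upper_bound_on_ball hr hm hball (R := 2 * R) (by positivity)
  have hfx₀ : 0 < f x₀ := hm.trans_le (hball x₀ (mem_ball_self hr))
  have hB0 : 0 < B := hfx₀.trans_le (hB x₀ (mem_closedBall_self (by positivity)))
  set M : ℝ := max (Real.log B) (Real.log (f x₀)) with hM
  have hdec : ∀ x, f x ≤ Real.exp (M + 1 - (2 * R)⁻¹ * ‖x - x₀‖) := by
    intro x
    rcases le_or_gt ‖x - x₀‖ (2 * R) with hx | hx
    · refine (hB x (by rwa [mem_closedBall, dist_eq_norm])).trans ?_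
      rw [← Real.log_le_iff_le_exp hB0]
      have : (2 * R)⁻¹ * ‖x - x₀‖ ≤ 1 := by
        rw [inv_mul_le_iff₀ (by positivity)]; linarith
      linarith [le_max_left (Real.log B) (Real.log (f x₀))]
    · rcases (hf.1 x).eq_or_lt with h0 | hpos
      · rw [← h0]; positivity
      have hs : 0 < ‖x - x₀‖ := by linarith
      set l : ℝ := 2 * R / ‖x - x₀‖ with hl
      have hl0 : 0 < l := by positivity
      have hl1 : l ≤ 1 := by rw [hl, div_le_one hs]; exact hx.le
      have h := hf.concaveOn_log.2 (x := x) hpos (y := x₀) hfx₀ hl0.le (sub_nonneg.2 hl1)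
        (by ring)
      have hy : f (l • x + (1 - l) • x₀) < Real.exp (a - 1) := by
        by_contra hcon
        have := hR (not_lt.1 hcon)
        have e : l • x + (1 - l) • x₀ - x₀ = l • (x - x₀) := by module
        rw [mem_closedBall, dist_eq_norm, e, norm_smul, Real.norm_eq_abs, abs_of_pos hl0, hl,
          div_mul_cancel₀ _ hs.ne'] at this
        linarith
      have hypos : 0 < f (l • x + (1 - l) • x₀) :=
        hf.concaveOn_log.1 (x := x) hpos (y := x₀) hfx₀ hl0.le (sub_nonneg.2 hl1) (by ring)
      have hy' := (Real.log_lt_iff_lt_exp hypos).2 hy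
      have hax : a ≤ Real.log (f x₀) := Real.log_le_log hm (hball x₀ (mem_ball_self hr))
      simp only [smul_eq_mul] at h
      have h2 : l * (Real.log (f x) - Real.log (f x₀)) ≤ -1 := by nlinarith
      have h3 : Real.log (f x) - Real.log (f x₀) ≤ -(l⁻¹) := by
        rw [← sub_nonneg]
        have : 0 ≤ l⁻¹ * (-1 - l * (Real.log (f x) - Real.log (f x₀))) :=
          mul_nonneg (by positivity) (by linarith)
        rw [mul_sub, inv_mul_cancel_left₀ hl0.ne'] at this
        linarith
      rw [← Real.log_le_iff_le_exp hpos]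
      have h4 : l⁻¹ = (2 * R)⁻¹ * ‖x - x₀‖ := by rw [hl, inv_div]; ring
      linarith [le_max_right (Real.log B) (Real.log (f x₀))]
  refine ⟨(2 * R)⁻¹, by positivity, M + 1 + (2 * R)⁻¹ * ‖x₀‖, fun x => (hdec x).trans ?_⟩
  rw [Real.exp_le_exp]
  have h5 : (2 * R)⁻¹ * ‖x‖ ≤ (2 * R)⁻¹ * (‖x - x₀‖ + ‖x₀‖) := by
    gcongr
    simpa using norm_add_le (x - x₀) x₀
  linarith

end LogConcaveFn
section Maximization

variable {n : ℕ}

/-- `(T, t)` is feasible for `g` if `g ≤ e^{t - ‖T ·‖}`. -/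
def IsFeasiblePair (g : En n → ℝ) (T : Matrix (Fin n) (Fin n) ℝ) (t : ℝ) : Prop :=
  ∀ x, g x ≤ Real.exp (t - ‖Matrix.toEuclideanLin T x‖)

namespace IsFeasiblePair

variable {g : En n → ℝ} {T : Matrix (Fin n) (Fin n) ℝ} {t : ℝ}

theorem midpoint {T' : Matrix (Fin n) (Fin n) ℝ} {t' : ℝ} (h : IsFeasiblePair g T t)
    (h' : IsFeasiblePair g T' t') :
    IsFeasiblePair g ((1 / 2 : ℝ) • (T + T')) ((t + t') / 2) := by
  intro x
  have hn : ‖Matrix.toEuclideanLin ((1 / 2 : ℝ) • (T + T')) x‖ ≤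
      (‖Matrix.toEuclideanLin T x‖ + ‖Matrix.toEuclideanLin T' x‖) / 2 := by
    rw [map_smul, map_add, LinearMap.smul_apply, LinearMap.add_apply, norm_smul]
    have := norm_add_le (Matrix.toEuclideanLin T x) (Matrix.toEuclideanLin T' x)
    norm_num
    linarith
  rcases le_total (t - ‖Matrix.toEuclideanLin T x‖) (t' - ‖Matrix.toEuclideanLin T' x‖)
    with hc | hc
  · exact (h x).trans (Real.exp_le_exp.2 (by linarith))
  · exact (h' x).trans (Real.exp_le_exp.2 (by linarith))

theorem norm_le {m : ℝ} (h : IsFeasiblePair g T t) (hm : 0 < m) {x : En n} (hx : m ≤ g x) :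
    ‖Matrix.toEuclideanLin T x‖ ≤ t - Real.log m := by
  have := (Real.log_le_iff_le_exp hm).2 (hx.trans (h x))
  linarith

theorem abs_entry_le {x₀ : En n} {r m : ℝ} (h : IsFeasiblePair g T t) (hr : 0 < r) (hm : 0 < m)
    (hball : ∀ x ∈ ball x₀ r, m ≤ g x) (i j : Fin n) :
    |T i j| ≤ 2 * (t - Real.log m) / r := by
  set e : En n := EuclideanSpace.single j 1 with he
  set v : En n := (r / 2) • e with hv
  have hvr : ‖v‖ < r := by
    rw [hv, norm_smul, he, PiLp.norm_single, Real.norm_eq_abs, abs_of_pos (half_pos hr)]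
    simpa using hr
  have h1 := h.norm_le hm (hball (x₀ + v) (by simpa [mem_ball, dist_eq_norm] using hvr))
  have h2 := h.norm_le hm (hball (x₀ - v) (by simpa [mem_ball, dist_eq_norm] using hvr))
  have h3 : r • Matrix.toEuclideanLin T e =
      Matrix.toEuclideanLin T (x₀ + v) - Matrix.toEuclideanLin T (x₀ - v) := by
    rw [← map_sub, ← map_smul, hv]
    congr 1
    module
  have h4 : r * ‖Matrix.toEuclideanLin T e‖ ≤ 2 * (t - Real.log m) := by
    have h5 := norm_sub_le (Matrix.toEuclideanLin T (x₀ + v)) (Matrix.toEuclideanLin T (x₀ - v))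
    rw [← h3, norm_smul, Real.norm_eq_abs, abs_of_pos hr] at h5
    linarith
  have h6 : T i j = Matrix.toEuclideanLin T e i := by
    simp [he, Matrix.toLpLin_apply]
  rw [le_div_iff₀ hr, mul_comm, h6]
  refine le_trans ?_ h4
  gcongr
  exact PiLp.norm_apply_le (Matrix.toEuclideanLin T e) i

theorem exp_neg_mul_det_le {x₀ : En n} {r m : ℝ} (h : IsFeasiblePair g T t) (hr : 0 < r)
    (hm : 0 < m) (hball : ∀ x ∈ ball x₀ r, m ≤ g x) :
    Real.exp (-t) * T.det ≤ Real.exp (-Real.log m) * (n.factorial * (2 / r) ^ n) *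
      ((t - Real.log m) ^ n * Real.exp (-(t - Real.log m))) := by
  have hd := Matrix.det_le (abv := AbsoluteValue.abs) (A := T) (h.abs_entry_le hr hm hball)
  rw [Fintype.card_fin, nsmul_eq_mul] at hd
  calc Real.exp (-t) * T.det
      ≤ Real.exp (-t) * (n.factorial * (2 * (t - Real.log m) / r) ^ n) := by
        gcongr
        exact (le_abs_self _).trans hd
    _ = _ := by
        have : -t = -Real.log m + -(t - Real.log m) := by ring
        rw [this, Real.exp_add, mul_div_right_comm, mul_pow]
        ring

theorem isClosed_setOf (g : En n → ℝ) :
    IsClosed {p : Matrix (Fin n) (Fin n) ℝ × ℝ | IsFeasiblePair g p.1 p.2} := by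
  simp only [IsFeasiblePair, ofPred_forall]
  refine isClosed_iInter fun x => isClosed_le continuous_const ?_
  simp only [Matrix.toLpLin_apply]
  refine Real.continuous_exp.comp (continuous_snd.sub (continuous_norm.comp ?_))
  exact (PiLp.continuous_toLp 2 _).comp (continuous_fst.matrix_mulVec continuous_const)

end IsFeasiblePair

theorem Matrix.isClosed_setOf_posSemidef {ι : Type*} [Fintype ι] :
    IsClosed {T : Matrix ι ι ℝ | T.PosSemidef} := by
  simp only [Matrix.posSemidef_iff_dotProduct_mulVec, ofPred_and, ofPred_forall]
  refine (isClosed_eq continuous_id.matrix_conjTranspose continuous_id).inter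
    (isClosed_iInter fun x => isClosed_le continuous_const ?_)
  exact continuous_const.dotProduct (continuous_id.matrix_mulVec continuous_const)

theorem exists_isFeasiblePair_maximizer {g : En n → ℝ} {x₀ : En n} {r m : ℝ} (hr : 0 < r)
    (hm : 0 < m) (hball : ∀ x ∈ ball x₀ r, m ≤ g x) {T' : Matrix (Fin n) (Fin n) ℝ} {t' : ℝ}
    (hT' : T'.PosDef) (h' : IsFeasiblePair g T' t') :
    ∃ (T₀ : Matrix (Fin n) (Fin n) ℝ) (t₀ : ℝ), T₀.PosDef ∧ IsFeasiblePair g T₀ t₀ ∧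
      ∀ (T : Matrix (Fin n) (Fin n) ℝ) (t : ℝ), T.PosDef → IsFeasiblePair g T t →
        Real.exp (-t) * T.det ≤ Real.exp (-t₀) * T₀.det := by
  set a : ℝ := Real.log m with ha
  have hv0 : 0 < Real.exp (-t') * T'.det := mul_pos (Real.exp_pos _) hT'.det_pos
  have hlim : Filter.Tendsto (fun t : ℝ => Real.exp (-a) * (n.factorial * (2 / r) ^ n) *
      ((t - a) ^ n * Real.exp (-(t - a)))) Filter.atTop (nhds 0) := by
    have := ((Real.tendsto_pow_mul_exp_neg_atTop_nhds_zero n).comp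
      (Filter.tendsto_atTop_add_const_right Filter.atTop (-a) Filter.tendsto_id)).const_mul
      (Real.exp (-a) * (n.factorial * (2 / r) ^ n))
    rw [mul_zero] at this
    exact this
  obtain ⟨M, hM⟩ := Filter.eventually_atTop.1 (hlim.eventually (gt_mem_nhds hv0))
  have hlarge : ∀ (T : Matrix (Fin n) (Fin n) ℝ) (t : ℝ), IsFeasiblePair g T t → M ≤ t →
      Real.exp (-t) * T.det < Real.exp (-t') * T'.det := fun T t h ht =>
    (h.exp_neg_mul_det_le hr hm hball).trans_lt (hM t ht)
  set K : Set (Matrix (Fin n) (Fin n) ℝ × ℝ) :=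
    {p | p.1.PosSemidef} ∩ {p | IsFeasiblePair g p.1 p.2} ∩ {p | p.2 ≤ M} with hK
  have hclosed : IsClosed K :=
    ((Matrix.isClosed_setOf_posSemidef.preimage continuous_fst).inter
      (IsFeasiblePair.isClosed_setOf g)).inter (isClosed_le continuous_snd continuous_const)
  set C : ℝ := 2 * (M - a) / r with hC
  have hbox : IsCompact ((Set.univ.pi fun _ : Fin n => Set.univ.pi fun _ : Fin n => Icc (-C) C) :
      Set (Matrix (Fin n) (Fin n) ℝ)) :=
    isCompact_univ_pi fun _ => isCompact_univ_pi fun _ => isCompact_Icc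
  have hcompact : IsCompact K := by
    refine (hbox.prod (isCompact_Icc (a := a) (b := M))).of_isClosed_subset hclosed ?_
    rintro ⟨T, t⟩ ⟨⟨-, hfeas⟩, htM⟩
    have htM : t ≤ M := htM
    have hfeas : IsFeasiblePair g T t := hfeas
    refine ⟨fun i _ j _ => abs_le.1 ((hfeas.abs_entry_le hr hm hball i j).trans ?_), ?_, htM⟩
    · rw [hC]
      gcongr
    · have := (norm_nonneg _).trans (hfeas.norm_le hm (hball x₀ (mem_ball_self hr)))
      exact sub_nonneg.1 this
  have hcont : Continuous fun p : Matrix (Fin n) (Fin n) ℝ × ℝ => Real.exp (-p.2) * p.1.det :=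
    (Real.continuous_exp.comp continuous_snd.neg).mul continuous_fst.matrix_det
  have hmem : ∀ (T : Matrix (Fin n) (Fin n) ℝ) (t : ℝ), T.PosDef → IsFeasiblePair g T t →
      t ≤ M → (T, t) ∈ K := fun T t hT h ht => ⟨⟨hT.posSemidef, h⟩, ht⟩
  have ht'M : t' ≤ M := le_of_not_ge fun h => (hlarge T' t' h' h).false
  obtain ⟨⟨T₀, t₀⟩, ⟨⟨hT₀, h₀⟩, -⟩, hmax⟩ :=
    hcompact.exists_isMaxOn ⟨_, hmem T' t' hT' h' ht'M⟩ hcont.continuousOn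
  have hge : Real.exp (-t') * T'.det ≤ Real.exp (-t₀) * T₀.det := hmax (hmem T' t' hT' h' ht'M)
  have hdet : 0 < T₀.det := pos_of_mul_pos_right (hv0.trans_le hge) (Real.exp_pos _).le
  refine ⟨T₀, t₀, (Matrix.PosSemidef.posDef_iff_det_ne_zero hT₀).2 hdet.ne', h₀,
    fun T t hT h => ?_⟩
  rcases le_total t M with ht | ht
  · exact hmax (hmem T t hT h ht)
  · exact (hlarge T t h ht).le.trans hge

theorem IsFeasiblePair.maximizer_unique {g : En n → ℝ} {T₀ T₁ : Matrix (Fin n) (Fin n) ℝ}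
    {t₀ t₁ : ℝ} (hT₀ : T₀.PosDef) (h₀ : IsFeasiblePair g T₀ t₀)
    (hmax : ∀ (T : Matrix (Fin n) (Fin n) ℝ) (t : ℝ), T.PosDef → IsFeasiblePair g T t →
      Real.exp (-t) * T.det ≤ Real.exp (-t₀) * T₀.det)
    (hT₁ : T₁.PosDef) (h₁ : IsFeasiblePair g T₁ t₁)
    (heq : Real.exp (-t₁) * T₁.det = Real.exp (-t₀) * T₀.det) : t₁ = t₀ ∧ T₁ = T₀ := by
  have hpd : ((1 / 2 : ℝ) • (T₁ + T₀)).PosDef := (hT₁.add hT₀).smul (by norm_num)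
  have hle := hmax _ _ hpd (h₁.midpoint h₀)
  have hT : T₁ = T₀ := by
    refine hT₁.eq_of_det_half_smul_add_sq_le hT₀ ?_
    have hsq := pow_le_pow_left₀ (mul_pos (Real.exp_pos _) hpd.det_pos).le hle 2
    have hexp : Real.exp (-((t₁ + t₀) / 2)) ^ 2 = Real.exp (-t₁) * Real.exp (-t₀) := by
      rw [← Real.exp_nat_mul, ← Real.exp_add]
      congr 1
      push_cast
      ring
    have hprod : (Real.exp (-t₀) * T₀.det) ^ 2 =
        Real.exp (-t₁) * Real.exp (-t₀) * (T₁.det * T₀.det) := by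
      rw [sq]
      nth_rewrite 1 [← heq]
      ring
    rw [mul_pow, hexp, hprod] at hsq
    exact le_of_mul_le_mul_left hsq (by positivity)
  refine ⟨?_, hT⟩
  rw [hT] at heq
  have := Real.exp_injective (mul_right_cancel₀ hT₀.det_pos.ne' heq)
  linarith

end Maximization

/-- for fixed `b`, the maximization of `e^{-t} det T` over symmetric
positive definite `T` and `t ∈ ℝ` subject to `‖Tx‖ - t ≤ ψ(x - b)` has a solution,
unique up to left composition with an orthogonal transformation. -/
theorem reduced_maximization_fixed_center {n : ℕ} (b : En n)
    (f : En n → ℝ)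
    (hlc : LogConcaveFn f)
    (hint : Integrable f)
    (hnd : (interior {x | 0 < f x}).Nonempty) :
    ∃ (T₀ : Matrix (Fin n) (Fin n) ℝ) (t₀ : ℝ),
      T₀.PosDef ∧
      (∀ x, f (x - b) ≤ Real.exp (t₀ - ‖Matrix.toEuclideanLin T₀ x‖)) ∧
      (∀ (T : Matrix (Fin n) (Fin n) ℝ) (t : ℝ), T.PosDef →
        (∀ x, f (x - b) ≤ Real.exp (t - ‖Matrix.toEuclideanLin T x‖)) →
        Real.exp (-t) * T.det ≤ Real.exp (-t₀) * T₀.det) ∧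
      -- uniqueness up to left orthogonal transformations
      (∀ (T₁ : Matrix (Fin n) (Fin n) ℝ) (t₁ : ℝ), T₁.PosDef →
        (∀ x, f (x - b) ≤ Real.exp (t₁ - ‖Matrix.toEuclideanLin T₁ x‖)) →
        Real.exp (-t₁) * T₁.det = Real.exp (-t₀) * T₀.det →
        t₁ = t₀ ∧ ∃ O ∈ Matrix.orthogonalGroup (Fin n) ℝ, T₁ = O * T₀) := by

  obtain ⟨x₀, r, hr, m, hm, hball⟩ := hlc.exists_ball_lower_bound hnd
  obtain ⟨c, hc, s, hdec⟩ := hlc.exists_exponential_decay hint hnd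
  have hball' : ∀ x ∈ ball (x₀ + b) r, m ≤ f (x - b) := fun x hx => hball _ (by
    rw [mem_ball, dist_eq_norm] at hx ⊢
    rwa [sub_sub, add_comm b])
  have hpd : (c • (1 : Matrix (Fin n) (Fin n) ℝ)).PosDef := Matrix.PosDef.one.smul hc
  have hfeas : IsFeasiblePair (fun x => f (x - b)) (c • 1) (s + c * ‖b‖) := by
    intro x
    refine (hdec (x - b)).trans (Real.exp_le_exp.2 ?_)
    have h1 : ‖Matrix.toEuclideanLin (c • (1 : Matrix (Fin n) (Fin n) ℝ)) x‖ = c * ‖x‖ := by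
      rw [map_smul, LinearMap.smul_apply, norm_smul, Real.norm_eq_abs, abs_of_pos hc]
      simp
    have h2 : c * ‖x‖ ≤ c * (‖x - b‖ + ‖b‖) := by
      gcongr
      simpa using norm_add_le (x - b) b
    rw [h1]
    linarith
  obtain ⟨T₀, t₀, hT₀, h₀, hmax⟩ := exists_isFeasiblePair_maximizer hr hm hball' hpd hfeas
  refine ⟨T₀, t₀, hT₀, h₀, hmax, fun T₁ t₁ hT₁ h₁ heq => ?_⟩
  obtain ⟨ht, hT⟩ := IsFeasiblePair.maximizer_unique hT₀ h₀ hmax hT₁ h₁ heq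
  exact ⟨ht, 1, one_mem _, by rw [hT, one_mul]⟩
end
end
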